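/- arXiv:1311.3199 — 9 statements merged into one kernel-verified Lean document; each statement's English description precedes it below -/
import Mathlib

section
/- Let A ∈ ℝ^{(n+1)×(n+1)} and F = q ∘ A ∘ ℓ. Let U be a linear subspace of ℝ^{n+1} not contained in U₀, set S_U = q(U \ (U ∩ U₀)), and suppose S_U is not contained in PF. Then U is A-invariant (i.e. A(U) ⊆ U) if and only if S_U is F-invariant (i.e. for every X ∈ S_U with X ∉ PF one has F(X) ∈ S_U). -/
open Matrix

/-- Projection from homogeneous coordinates: `q(a₁,…,aₙ₊₁) = (a₁/aₙ₊₁,…,aₙ/aₙ₊₁)`. -/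
noncomputable def qmap {n : ℕ} (a : Fin (n + 1) → ℝ) : Fin n → ℝ :=
  fun i => a i.castSucc / a (Fin.last n)

/-- Transformation to homogeneous coordinates: `ℓ(x₁,…,xₙ) = (x₁,…,xₙ,1)`. -/
def lhom {n : ℕ} (x : Fin n → ℝ) : Fin (n + 1) → ℝ := Fin.snoc x 1

/-- The rational map `F = q ∘ A ∘ ℓ`. -/
noncomputable def Fmap {n : ℕ} (A : Matrix (Fin (n + 1)) (Fin (n + 1)) ℝ)
    (X : Fin n → ℝ) : Fin n → ℝ :=
  qmap (A.mulVec (lhom X))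

theorem lhom_qmap {n : ℕ} {a : Fin (n + 1) → ℝ} (ha : a (Fin.last n) ≠ 0) :
    lhom (qmap a) = (a (Fin.last n))⁻¹ • a := by
  funext i
  refine Fin.lastCases ?_ (fun j => ?_) i
  · simp [lhom, ha]
  · simp [lhom, qmap, div_eq_inv_mul]

theorem qmap_mem_image_iff {n : ℕ} (U : Submodule ℝ (Fin (n + 1) → ℝ))
    {a : Fin (n + 1) → ℝ} (ha : a (Fin.last n) ≠ 0) :
    qmap a ∈ qmap '' {u | u ∈ U ∧ u (Fin.last n) ≠ 0} ↔ a ∈ U := by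
  refine ⟨?_, fun h => ⟨a, ⟨h, ha⟩, rfl⟩⟩
  rintro ⟨u, ⟨hu, hu0⟩, h⟩
  have h' := congrArg lhom h
  rw [lhom_qmap hu0, lhom_qmap ha] at h'
  rw [← U.smul_mem_iff (inv_ne_zero ha), ← h']
  exact U.smul_mem _ hu

theorem exists_add_mul_ne_zero {K : Type*} [Field K] [Infinite K] (a b : K) {c d : K}
    (hc : c ≠ 0) (hd : d ≠ 0) : ∃ t : K, a + t * c ≠ 0 ∧ b + t * d ≠ 0 := by
  classical
  obtain ⟨t, ht⟩ := Infinite.exists_notMem_finset ({-a / c, -b / d} : Finset K)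
  simp only [Finset.mem_insert, Finset.mem_singleton, not_or] at ht
  refine ⟨t, fun h => ht.1 ?_, fun h => ht.2 ?_⟩
  · rw [eq_div_iff hc]; linear_combination h
  · rw [eq_div_iff hd]; linear_combination h

theorem stmt_3 {n : ℕ} (hn : 2 ≤ n) (A : Matrix (Fin (n + 1)) (Fin (n + 1)) ℝ)
    (U : Submodule ℝ (Fin (n + 1) → ℝ))
    -- `U` is not contained in `U₀`
    (hU : ∃ u ∈ U, u (Fin.last n) ≠ 0)
    -- `S_U = q(U \ (U ∩ U₀))` is not contained in the principal forbidden hyperplane `PF`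
    (hS : ∃ X ∈ qmap '' {u | u ∈ U ∧ u (Fin.last n) ≠ 0},
            A.mulVec (lhom X) (Fin.last n) ≠ 0) :
    -- `U` is `A`-invariant iff `S_U` is `F`-invariant
    (∀ u ∈ U, A.mulVec u ∈ U) ↔
      ∀ X ∈ qmap '' {u | u ∈ U ∧ u (Fin.last n) ≠ 0},
        A.mulVec (lhom X) (Fin.last n) ≠ 0 →
          Fmap A X ∈ qmap '' {u | u ∈ U ∧ u (Fin.last n) ≠ 0} := by
  have mulVec_last {u : Fin (n + 1) → ℝ} (hu : u (Fin.last n) ≠ 0) :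
      A.mulVec (lhom (qmap u)) (Fin.last n) ≠ 0 ↔ A.mulVec u (Fin.last n) ≠ 0 := by
    simp [lhom_qmap hu, mulVec_smul, hu]
  have mulVec_mem {u : Fin (n + 1) → ℝ} (hu : u (Fin.last n) ≠ 0) :
      A.mulVec (lhom (qmap u)) ∈ U ↔ A.mulVec u ∈ U := by
    rw [lhom_qmap hu, mulVec_smul, U.smul_mem_iff (inv_ne_zero hu)]
  constructor
  · rintro hA _ ⟨u, ⟨hu, hu0⟩, rfl⟩ hX
    exact (qmap_mem_image_iff U hX).2 ((mulVec_mem hu0).2 (hA u hu))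
  · intro hF
    have mem_of_ne {u : Fin (n + 1) → ℝ} (hu : u ∈ U) (hu0 : u (Fin.last n) ≠ 0)
        (hAu : A.mulVec u (Fin.last n) ≠ 0) : A.mulVec u ∈ U :=
      (mulVec_mem hu0).1 <| (qmap_mem_image_iff U ((mulVec_last hu0).2 hAu)).1 <|
        hF _ ⟨u, ⟨hu, hu0⟩, rfl⟩ ((mulVec_last hu0).2 hAu)
    obtain ⟨_, ⟨w, ⟨hw, hw0⟩, rfl⟩, hX⟩ := hS
    have hAw := (mulVec_last hw0).1 hX
    intro u hu
    obtain ⟨t, h₁, h₂⟩ := exists_add_mul_ne_zero (u (Fin.last n)) (A.mulVec u (Fin.last n)) hw0 hAw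
    have h := mem_of_ne (u := u + t • w) (U.add_mem hu (U.smul_mem t hw)) (by simpa using h₁)
      (by simpa [mulVec_add, mulVec_smul] using h₂)
    rw [mulVec_add, mulVec_smul] at h
    exact (U.add_mem_iff_left (U.smul_mem t (mem_of_ne hw hw0 hAw))).1 h
end

section
/- Let A ∈ ℝ^{(n+1)×(n+1)} with det(A) = ±1, let F = q ∘ A ∘ ℓ, and let M ∈ ℝ^{(n+1)×(n+1)} be an invertible indefinite symmetric matrix. Then the quadric Q(M) is F-invariant if and only if AᵀMA = εM for some ε ∈ {1,−1}; moreover, in that case Aᵀ = εMA⁻¹M⁻¹, so A is similar to εA⁻¹. -/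
open Matrix

/-- A real function on a vector space whose restriction to every line is a polynomial. -/
def IsPolyOnLines {V : Type*} [AddCommGroup V] [Module ℝ V] (g : V → ℝ) : Prop :=
  ∀ a b : V, ∃ P : Polynomial ℝ, ∀ t : ℝ, P.eval t = g (a + t • b)

section Forms

variable {V : Type*} [AddCommGroup V] [Module ℝ V]

namespace IsPolyOnLines

theorem const (c : ℝ) : IsPolyOnLines fun _ : V => c :=
  fun _ _ => ⟨Polynomial.C c, fun t => by simp⟩

theorem linear (f : V →ₗ[ℝ] ℝ) : IsPolyOnLines fun y => f y :=
  fun a b => ⟨Polynomial.C (f a) + Polynomial.X * Polynomial.C (f b), fun t => by simp; ring⟩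

theorem add {g h : V → ℝ} (hg : IsPolyOnLines g) (hh : IsPolyOnLines h) :
    IsPolyOnLines fun y => g y + h y := fun a b => by
  obtain ⟨P, hP⟩ := hg a b
  obtain ⟨Q, hQ⟩ := hh a b
  exact ⟨P + Q, fun t => by simp [hP, hQ]⟩

theorem mul {g h : V → ℝ} (hg : IsPolyOnLines g) (hh : IsPolyOnLines h) :
    IsPolyOnLines fun y => g y * h y := fun a b => by
  obtain ⟨P, hP⟩ := hg a b
  obtain ⟨Q, hQ⟩ := hh a b
  exact ⟨P * Q, fun t => by simp [hP, hQ]⟩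

theorem quadratic (B : V →ₗ[ℝ] V →ₗ[ℝ] ℝ) : IsPolyOnLines fun y => B y y :=
  fun a b => ⟨Polynomial.C (B a a) + Polynomial.X * Polynomial.C (B a b + B b a) +
    Polynomial.X ^ 2 * Polynomial.C (B b b), fun t => by simp; ring⟩

theorem eq_zero_or_eq_zero {g h : V → ℝ} (hg : IsPolyOnLines g) (hh : IsPolyOnLines h)
    (hgh : ∀ y, g y * h y = 0) : (∀ y, g y = 0) ∨ ∀ y, h y = 0 := by
  by_contra! hcon
  obtain ⟨⟨a, ha⟩, b, hb⟩ := hcon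
  obtain ⟨P, hP⟩ := hg a (b - a)
  obtain ⟨Q, hQ⟩ := hh a (b - a)
  have hPQ : P * Q = 0 := Polynomial.funext fun t => by simp [hP, hQ, hgh]
  rcases mul_eq_zero.1 hPQ with h0 | h0
  · exact ha (by simpa [h0] using (hP 0).symm)
  · exact hb (by simpa [h0] using (hQ 1).symm)

end IsPolyOnLines

theorem exists_ne_zero_common_ker (hV : 3 ≤ Module.finrank ℝ V)
    (f g : V →ₗ[ℝ] ℝ) : ∃ y ≠ 0, f y = 0 ∧ g y = 0 := by
  have : FiniteDimensional ℝ V := Module.finite_of_finrank_pos (by omega)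
  have hker : LinearMap.ker (f.prod g) ≠ ⊥ :=
    LinearMap.ker_ne_bot_of_finrank_lt (by simp; omega)
  obtain ⟨y, hy, hy0⟩ := Submodule.exists_mem_ne_zero_of_ne_bot hker
  have : f y = 0 ∧ g y = 0 := by simpa using hy
  exact ⟨y, hy0, this⟩

variable {B R : V →ₗ[ℝ] V →ₗ[ℝ] ℝ}

/-- The linear form `L` does not vanish on the image of `y ↦ B y y • v - 2 * B v y • y`, a
parametrization of the isotropic cone of `B` by reflections of `v`. -/
theorem exists_linear_reflection_ne_zero (hV : 3 ≤ Module.finrank ℝ V)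
    (hB : ∀ x y, B x y = B y x) (hnd : ∀ y, (∀ z, B y z = 0) → y = 0)
    {L : V →ₗ[ℝ] ℝ} (hL : L ≠ 0) {v : V} (hv0 : v ≠ 0) :
    ¬ ∀ y, L (B y y • v - (2 * B v y) • y) = 0 := by
  intro h
  simp only [map_sub, map_smul, smul_eq_mul] at h
  by_cases hLv : L v = 0
  · have hmul : ∀ y, B v y * L y = 0 := fun y => by have := h y; rw [hLv] at this; linarith
    rcases (IsPolyOnLines.linear (B v)).eq_zero_or_eq_zero (IsPolyOnLines.linear L) hmul with h1 | h1
    · exact hv0 (hnd v h1)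
    · exact hL (LinearMap.ext h1)
  · obtain ⟨y, hy0, hBy, hLy⟩ := exists_ne_zero_common_ker hV (B v) L
    refine hy0 (hnd y fun z => ?_)
    have h1 := h (y + z)
    have h2 := h z
    have h3 := h y
    simp only [map_add, LinearMap.add_apply, hBy, hLy, hB z y] at h1 h2 h3
    have : B y z * L v = 0 := by linarith
    exact (mul_eq_zero.1 this).resolve_right hLv

theorem exists_orthogonal_anisotropic (hV : 3 ≤ Module.finrank ℝ V)
    (hB : ∀ x y, B x y = B y x) (hnd : ∀ y, (∀ z, B y z = 0) → y = 0) {v : V} (hv0 : v ≠ 0) :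
    ∃ y, B v y = 0 ∧ B y y ≠ 0 := by
  by_contra! h
  obtain ⟨z, hz⟩ : ∃ z, B v z ≠ 0 := by
    by_contra! hz
    exact hv0 (hnd v hz)
  obtain ⟨y, hy0, hvy, hzy⟩ := exists_ne_zero_common_ker hV (B v) (B z)
  refine hy0 (hnd y fun x => ?_)
  have hx : B v (B v z • x - B v x • z) = 0 := by simp; ring
  have h1 := h y hvy
  have h2 := h _ hx
  have h3 := h (y + (B v z • x - B v x • z)) (by rw [map_add, hx, hvy, add_zero])
  have hsymm := hB (B v z • x - B v x • z) y
  generalize hd : B v z • x - B v x • z = d at *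
  simp only [map_add, LinearMap.add_apply] at h3
  have h4 : B y d = 0 := by linarith
  rw [← hd] at h4
  simp only [map_sub, map_smul, smul_eq_mul, hB y z, hzy] at h4
  exact (mul_eq_zero.1 (by linarith : B v z * B y x = 0)).resolve_left hz

/-- A quadratic form that vanishes on the isotropic cone of `B` outside two hyperplanes vanishes on
the whole cone. -/
theorem isotropic_of_isotropic_off_hyperplanes (hV : 3 ≤ Module.finrank ℝ V)
    (hB : ∀ x y, B x y = B y x) (hnd : ∀ y, (∀ z, B y z = 0) → y = 0)
    {L₁ L₂ : V →ₗ[ℝ] ℝ} (hL₁ : L₁ ≠ 0) (hL₂ : L₂ ≠ 0)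
    (h : ∀ v, B v v = 0 → L₁ v ≠ 0 → L₂ v ≠ 0 → R v v = 0) {v : V} (hv : B v v = 0) :
    R v v = 0 := by
  rcases eq_or_ne v 0 with rfl | hv0
  · simp
  have hlin (L : V →ₗ[ℝ] ℝ) : IsPolyOnLines fun y => L (B y y • v - (2 * B v y) • y) := by
    have := ((IsPolyOnLines.quadratic B).mul (.const (L v))).add
      (((IsPolyOnLines.const (-2)).mul (.linear (B v))).mul (.linear L))
    convert this using 2
    simp; ring
  have hquad : IsPolyOnLines fun y =>
      R (B y y • v - (2 * B v y) • y) (B y y • v - (2 * B v y) • y) := by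
    have hQ := IsPolyOnLines.quadratic B
    have hl := IsPolyOnLines.linear (B v)
    have := (((hQ.mul hQ).mul (.const (R v v))).add
      (((hQ.mul hl).mul (.const (-2))).mul (.linear (R v + R.flip v)))).add
      (((hl.mul hl).mul (.const 4)).mul (.quadratic R))
    convert this using 2
    simp; ring
  have hprod : ∀ y, L₁ (B y y • v - (2 * B v y) • y) * L₂ (B y y • v - (2 * B v y) • y) *
      R (B y y • v - (2 * B v y) • y) (B y y • v - (2 * B v y) • y) = 0 := by
    intro y
    by_contra hne
    simp only [mul_eq_zero, not_or] at hne
    refine hne.2 (h _ ?_ hne.1.1 hne.1.2)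
    simp [hv, hB y v]; ring
  have hR : ∀ y, R (B y y • v - (2 * B v y) • y) (B y y • v - (2 * B v y) • y) = 0 := by
    rcases ((hlin L₁).mul (hlin L₂)).eq_zero_or_eq_zero hquad hprod with h1 | h1
    · rcases (hlin L₁).eq_zero_or_eq_zero (hlin L₂) h1 with h2 | h2
      · exact absurd h2 (exists_linear_reflection_ne_zero hV hB hnd hL₁ hv0)
      · exact absurd h2 (exists_linear_reflection_ne_zero hV hB hnd hL₂ hv0)
    · exact h1
  obtain ⟨y, hvy, hyy⟩ := exists_orthogonal_anisotropic hV hB hnd hv0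
  simpa [hvy, hyy] using hR y

theorem mul_eq_mul_of_isotropic (hB : ∀ x y, B x y = B y x)
    (h : ∀ v, B v v = 0 → R v v = 0) {u w : V} (hu : 0 < B u u) (hw : B w w < 0) :
    R u u * B w w = R w w * B u u := by
  obtain ⟨s, hs⟩ : ∃ s : ℝ, discrim (B w w) (2 * B u w) (B u u) = s * s :=
    ⟨_, (Real.mul_self_sqrt (by unfold discrim; nlinarith [sq_nonneg (B u w)])).symm⟩
  have hs0 : s ≠ 0 := by
    rintro rfl
    unfold discrim at hs
    nlinarith [sq_nonneg (B u w)]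
  have key (t : ℝ) (ht : B w w * (t * t) + 2 * B u w * t + B u u = 0) :
      R w w * (t * t) + (R u w + R w u) * t + R u u = 0 := by
    have := h (u + t • w) (by simp [hB w u]; linarith)
    simp at this
    linarith
  have h1 := (quadratic_eq_zero_iff hw.ne hs (x := (-(2 * B u w) + s) / (2 * B w w))).2 (.inl rfl)
  have h2 := (quadratic_eq_zero_iff hw.ne hs (x := (-(2 * B u w) - s) / (2 * B w w))).2 (.inr rfl)
  set t₁ := (-(2 * B u w) + s) / (2 * B w w) with ht₁
  set t₂ := (-(2 * B u w) - s) / (2 * B w w) with ht₂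
  have hne : t₁ - t₂ ≠ 0 := by
    rw [ht₁, ht₂, ← sub_div]
    have := hw.ne
    refine div_ne_zero ?_ (by simpa)
    intro h0
    apply hs0
    linarith
  have k1 := key _ h1
  have k2 := key _ h2
  have e1 : B w w * (t₁ + t₂) + 2 * B u w = 0 :=
    mul_left_cancel₀ hne (by linear_combination h1 - h2)
  have e2 : R w w * (t₁ + t₂) + (R u w + R w u) = 0 :=
    mul_left_cancel₀ hne (by linear_combination k1 - k2)
  linear_combination B w w * k1 - R w w * h1 - t₁ * B w w * e2 + t₁ * R w w * e1

/-- A quadratic form vanishing on the isotropic cone of an indefinite form is a multiple of it. -/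
theorem exists_eq_mul_of_isotropic (hB : ∀ x y, B x y = B y x)
    (h : ∀ v, B v v = 0 → R v v = 0) (hpos : ∃ u, 0 < B u u) (hneg : ∃ w, B w w < 0) :
    ∃ c : ℝ, ∀ v, R v v = c * B v v := by
  obtain ⟨u, hu⟩ := hpos
  obtain ⟨w, hw⟩ := hneg
  refine ⟨R u u / B u u, fun v => ?_⟩
  rcases lt_trichotomy (B v v) 0 with hv | hv | hv
  · have := mul_eq_mul_of_isotropic hB h hu hv
    field_simp
    linarith
  · simp [hv, h v hv]
  · have h1 := mul_eq_mul_of_isotropic hB h hu hw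
    have h2 := mul_eq_mul_of_isotropic hB h hv hw
    field_simp
    exact mul_right_cancel₀ hw.ne (by linear_combination B u u * h2 - B v v * h1)

end Forms

section SelfAdjoint

open Polynomial

variable {K : Type*} [Field K]

theorem Polynomial.exists_linear_nondegenerate_mod {g : K[X]} (hg : g ≠ 0) :
    ∃ l : K[X] →ₗ[K] K, (∀ f, g ∣ f → l f = 0) ∧ ∀ a, (∀ b, l (a * b) = 0) → g ∣ a := by
  wlog hmon : g.Monic generalizing g
  · obtain ⟨l, h1, h2⟩ := this (mul_ne_zero hg (by simpa using hg)) (monic_mul_leadingCoeff_inv hg)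
    have hass : Associated (g * C g.leadingCoeff⁻¹) g :=
      associated_mul_unit_left _ _ (isUnit_C.2 (by simpa using hg))
    exact ⟨l, fun f hf => h1 f (hass.dvd_iff_dvd_left.2 hf),
      fun a ha => hass.dvd_iff_dvd_left.1 (h2 a ha)⟩
  refine ⟨lcoeff K (g.natDegree - 1) ∘ₗ modByMonicHom g, fun f hf => ?_, fun a ha => ?_⟩
  · simp [(modByMonic_eq_zero_iff_dvd hmon).2 hf]
  · rw [← modByMonic_eq_zero_iff_dvd hmon]
    by_contra hr
    set r := a %ₘ g with hrdef
    have hdeg : r.degree < g.degree := degree_modByMonic_lt a hmon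
    have hnat : r.natDegree < g.natDegree := natDegree_lt_natDegree hr hdeg
    have hmod : (a * X ^ (g.natDegree - 1 - r.natDegree)) %ₘ g =
        r * X ^ (g.natDegree - 1 - r.natDegree) := by
      have hself : (r * X ^ (g.natDegree - 1 - r.natDegree)) %ₘ g =
          r * X ^ (g.natDegree - 1 - r.natDegree) := by
        refine (modByMonic_eq_self_iff hmon).2 (degree_lt_degree ?_)
        rw [natDegree_mul_X_pow _ hr]
        omega
      rw [← hself, ← sub_eq_zero, ← sub_modByMonic, modByMonic_eq_zero_iff_dvd hmon, ← sub_mul]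
      refine Dvd.dvd.mul_right ?_ _
      rw [← modByMonic_eq_zero_iff_dvd hmon, sub_modByMonic, hrdef,
        (modByMonic_eq_self_iff hmon).2 hdeg, sub_self]
    have := ha (X ^ (g.natDegree - 1 - r.natDegree))
    simp only [LinearMap.comp_apply, modByMonicHom_apply, hmod, lcoeff_apply] at this
    rw [coeff_mul_X_pow', if_pos (by omega)] at this
    rw [show g.natDegree - 1 - (g.natDegree - 1 - r.natDegree) = r.natDegree by omega] at this
    exact hr (leadingCoeff_eq_zero.1 this)

theorem Polynomial.exists_linear_quotient_nondegenerate {g : K[X]} (hg : g ≠ 0) :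
    ∃ l : (K[X] ⧸ Ideal.span {g}) →ₗ[K] K, ∀ a, (∀ b, l (a * b) = 0) → a = 0 := by
  obtain ⟨l, h1, h2⟩ := exists_linear_nondegenerate_mod hg
  refine ⟨(Submodule.liftQ ((Ideal.span {g}).restrictScalars K) l fun f hf =>
    h1 f (Ideal.mem_span_singleton.1 hf)) ∘ₗ
      (Submodule.Quotient.restrictScalarsEquiv K (Ideal.span {g})).symm.toLinearMap, ?_⟩
  intro a ha
  obtain ⟨a, rfl⟩ := Ideal.Quotient.mk_surjective a
  rw [Ideal.Quotient.eq_zero_iff_mem, Ideal.mem_span_singleton]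
  exact h2 a fun b => ha (Ideal.Quotient.mk _ b)

/-- Every endomorphism of a finite-dimensional space is self-adjoint for some nondegenerate
bilinear form. -/
theorem Module.End.exists_nondegenerate_selfAdjoint {V : Type*} [AddCommGroup V] [Module K V]
    [FiniteDimensional K V] (f : Module.End K V) :
    ∃ B : V →ₗ[K] V →ₗ[K] K, (∀ v w, B (f v) w = B v (f w)) ∧ ∀ v, (∀ w, B v w = 0) → v = 0 := by
  classical
  obtain ⟨ι, _, p, hp, e, ⟨φ⟩⟩ := Module.equiv_directSum_of_isTorsion
    (Module.AEval.isTorsion_of_finiteDimensional K V f)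
  choose l hl using fun i => exists_linear_quotient_nondegenerate (pow_ne_zero (e i) (hp i).ne_zero)
  let ψ (i : ι) (v : V) : K[X] ⧸ Ideal.span {p i ^ e i} := φ (Module.AEval.of K V f v) i
  have hadd (i v w) : ψ i (v + w) = ψ i v + ψ i w := by simp [ψ]
  have hsmul (i) (c : K) (v) : ψ i (c • v) = c • ψ i v := by
    have : ψ i (c • v) = (C c : K[X]) • ψ i v := by
      simp only [ψ, map_smul]
      rw [← Module.AEval.C_smul, map_smul]
      rfl
    rw [this, ← algebraMap_eq, algebraMap_smul]
  have hX (i v) : ψ i (f v) = (X : K[X]) • ψ i v := by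
    simp only [ψ]
    rw [← Module.End.smul_def, ← Module.AEval.X_smul_of, map_smul]
    rfl
  refine ⟨LinearMap.mk₂ K (fun v w => ∑ i, l i (ψ i v * ψ i w)) ?_ ?_ ?_ ?_, ?_, ?_⟩
  · intro v v' w
    simp [hadd, add_mul, Finset.sum_add_distrib]
  · intro c v w
    simp only [hsmul, smul_mul_assoc, map_smul, Finset.smul_sum]
  · intro v w w'
    simp [hadd, mul_add, Finset.sum_add_distrib]
  · intro c v w
    simp only [hsmul, mul_smul_comm, map_smul, Finset.smul_sum]
  · intro v w
    simp only [LinearMap.mk₂_apply, hX, smul_mul_assoc, mul_smul_comm]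
  · intro v hv
    have hz : φ (Module.AEval.of K V f v) = 0 := by
      refine DFinsupp.ext fun i => hl i _ fun b => ?_
      have := hv ((Module.AEval.of K V f).symm (φ.symm (DirectSum.of _ i b)))
      rw [LinearMap.mk₂_apply, Finset.sum_eq_single i] at this
      · simpa [ψ] using this
      · intro j _ hj
        simp [ψ, DirectSum.of_eq_of_ne _ _ _ hj]
      · simp
    simpa using hz

theorem Matrix.exists_isUnit_transpose_mul_eq {m : Type*} [Fintype m] [DecidableEq m]
    (A : Matrix m m K) : ∃ S : Matrix m m K, IsUnit S ∧ Aᵀ * S = S * A := by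
  obtain ⟨B, h1, h2⟩ := Module.End.exists_nondegenerate_selfAdjoint (Matrix.toLin' A)
  set S := LinearMap.toMatrix₂' K B with hS
  have hB (v w) : B v w = v ⬝ᵥ S *ᵥ w := by
    rw [← Matrix.toLinearMap₂'_apply', hS, Matrix.toLinearMap₂'_toMatrix']
  refine ⟨S, ?_, ?_⟩
  · rw [← Matrix.isUnit_transpose, ← Matrix.mulVec_injective_iff_isUnit]
    refine (injective_iff_map_eq_zero (Matrix.mulVecLin Sᵀ)).2 fun v hv => h2 v fun w => ?_
    rw [hB, dotProduct_mulVec, ← mulVec_transpose]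
    rw [Matrix.mulVecLin_apply] at hv
    simp [hv]
  · refine Matrix.ext_of_mulVec_single fun j => ?_
    refine dotProduct_eq _ _ fun w => ?_
    have := h1 w (Pi.single j 1)
    simp only [hB, toLin'_apply] at this
    rw [dotProduct_comm, dotProduct_comm _ w, ← mulVec_mulVec, ← mulVec_mulVec, ← this,
      dotProduct_mulVec, vecMul_transpose]

end SelfAdjoint

theorem lhom_last {n : ℕ} (x : Fin n → ℝ) : lhom x (Fin.last n) = 1 := by
  simp [lhom]

theorem smul_lhom_qmap {n : ℕ} {a : Fin (n + 1) → ℝ} (ha : a (Fin.last n) ≠ 0) :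
    a (Fin.last n) • lhom (qmap a) = a := by
  ext i
  refine Fin.lastCases ?_ (fun j => ?_) i
  · simp [lhom]
  · simp only [lhom, qmap, Pi.smul_apply, Fin.snoc_castSucc, smul_eq_mul]
    field_simp

theorem quadratic_smul_eq_zero_iff {m : Type*} [Fintype m] (M : Matrix m m ℝ) {s : ℝ} (hs : s ≠ 0)
    (v : m → ℝ) : (s • v) ⬝ᵥ M *ᵥ (s • v) = 0 ↔ v ⬝ᵥ M *ᵥ v = 0 := by
  simp [mulVec_smul, hs]

theorem quadratic_mulVec {m : Type*} [Fintype m] (A M : Matrix m m ℝ) (v : m → ℝ) :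
    (A *ᵥ v) ⬝ᵥ M *ᵥ (A *ᵥ v) = v ⬝ᵥ (Aᵀ * M * A) *ᵥ v := by
  rw [← mulVec_mulVec, ← mulVec_mulVec, dotProduct_mulVec v Aᵀ, vecMul_transpose]

theorem Matrix.IsSymm.ext_quadratic {m : Type*} [Fintype m] [DecidableEq m] {M N : Matrix m m ℝ}
    (hM : M.IsSymm) (hN : N.IsSymm) (h : ∀ v, v ⬝ᵥ M *ᵥ v = v ⬝ᵥ N *ᵥ v) : M = N := by
  ext i j
  have hi := h (Pi.single i 1)
  have hj := h (Pi.single j 1)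
  have hij := h (Pi.single i 1 + Pi.single j 1)
  simp [mulVec_add, add_dotProduct, dotProduct_add] at hi hj hij
  have h1 := hM.apply i j
  have h2 := hN.apply i j
  linarith

/-- If `Q(M)` is invariant under `F = q ∘ A ∘ ℓ`, then `AᵀMA` vanishes on the whole cone of `M`. -/
theorem isotropic_of_invariant {n : ℕ} (hn : 2 ≤ n) {A M : Matrix (Fin (n + 1)) (Fin (n + 1)) ℝ}
    (hA : A.det ≠ 0) (hM : M.det ≠ 0) (hsymm : M.IsSymm)
    (hinv : ∀ X : Fin n → ℝ, lhom X ⬝ᵥ M *ᵥ lhom X = 0 → (A *ᵥ lhom X) (Fin.last n) ≠ 0 →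
      lhom (Fmap A X) ⬝ᵥ M *ᵥ lhom (Fmap A X) = 0)
    {v : Fin (n + 1) → ℝ} (hv : v ⬝ᵥ M *ᵥ v = 0) : v ⬝ᵥ (Aᵀ * M * A) *ᵥ v = 0 := by
  let L : (Fin (n + 1) → ℝ) →ₗ[ℝ] ℝ := LinearMap.proj (Fin.last n)
  have hL : L ≠ 0 := fun h => by
    simpa [L] using LinearMap.congr_fun h (Pi.single (Fin.last n) 1)
  have hLA : L ∘ₗ A.mulVecLin ≠ 0 := fun h => by
    have := LinearMap.congr_fun h (A⁻¹ *ᵥ Pi.single (Fin.last n) 1)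
    rw [LinearMap.comp_apply, mulVecLin_apply, mulVec_mulVec, mul_nonsing_inv A hA.isUnit,
      one_mulVec] at this
    simp [L] at this
  have hB : ∀ x y, Matrix.toBilin' M x y = Matrix.toBilin' M y x := fun x y => by
    rw [Matrix.toBilin'_apply', Matrix.toBilin'_apply', dotProduct_mulVec, ← mulVec_transpose,
      hsymm.eq, dotProduct_comm]
  have hnd : ∀ y, (∀ z, Matrix.toBilin' M y z = 0) → y = 0 := fun y hy =>
    Matrix.eq_zero_of_mulVec_eq_zero hM (dotProduct_eq _ _ fun z => by
      have := hB y z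
      rw [hy, Matrix.toBilin'_apply'] at this
      rw [dotProduct_comm, ← this, zero_dotProduct])
  have key := isotropic_of_isotropic_off_hyperplanes (B := Matrix.toBilin' M)
    (R := Matrix.toBilin' (Aᵀ * M * A)) (by simp; omega) hB hnd hL hLA
  simp only [Matrix.toBilin'_apply'] at key
  refine key (fun u hu h1 h2 => ?_) hv
  change u (Fin.last n) ≠ 0 at h1
  change (A *ᵥ u) (Fin.last n) ≠ 0 at h2
  have hu' := smul_lhom_qmap h1
  set s := u (Fin.last n)
  rw [← quadratic_mulVec]
  rw [← hu'] at hu h2 ⊢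
  rw [mulVec_smul, Pi.smul_apply, smul_eq_mul] at h2
  have h3 := right_ne_zero_of_mul h2
  have h4 := hinv (qmap u) ((quadratic_smul_eq_zero_iff M h1 _).1 hu) h3
  rw [mulVec_smul, quadratic_smul_eq_zero_iff M h1, ← smul_lhom_qmap h3,
    quadratic_smul_eq_zero_iff M h3]
  exact h4

theorem exists_sign_of_invariant {n : ℕ} (hn : 2 ≤ n) {A M : Matrix (Fin (n + 1)) (Fin (n + 1)) ℝ}
    (hdet : A.det = 1 ∨ A.det = -1) (hM : M.det ≠ 0) (hsymm : M.IsSymm)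
    (hpos : ∃ v : Fin (n + 1) → ℝ, 0 < v ⬝ᵥ M *ᵥ v)
    (hneg : ∃ w : Fin (n + 1) → ℝ, w ⬝ᵥ M *ᵥ w < 0)
    (hinv : ∀ X : Fin n → ℝ, lhom X ⬝ᵥ M *ᵥ lhom X = 0 → (A *ᵥ lhom X) (Fin.last n) ≠ 0 →
      lhom (Fmap A X) ⬝ᵥ M *ᵥ lhom (Fmap A X) = 0) :
    ∃ ε : ℝ, (ε = 1 ∨ ε = -1) ∧ Aᵀ * M * A = ε • M := by
  have hA : A.det ≠ 0 := by rcases hdet with h | h <;> simp [h]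
  obtain ⟨c, hc⟩ := exists_eq_mul_of_isotropic (B := Matrix.toBilin' M)
    (R := Matrix.toBilin' (Aᵀ * M * A))
    (fun x y => by
      rw [Matrix.toBilin'_apply', Matrix.toBilin'_apply', dotProduct_mulVec, ← mulVec_transpose,
        hsymm.eq, dotProduct_comm])
    (fun v hv => by
      rw [Matrix.toBilin'_apply'] at hv ⊢
      exact isotropic_of_invariant hn hA hM hsymm hinv hv)
    (by simpa only [Matrix.toBilin'_apply'] using hpos)
    (by simpa only [Matrix.toBilin'_apply'] using hneg)
  simp only [Matrix.toBilin'_apply'] at hc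
  have hN : Aᵀ * M * A = c • M := by
    refine Matrix.IsSymm.ext_quadratic ?_ (hsymm.smul c) fun v => ?_
    · simp [Matrix.IsSymm, hsymm.eq, Matrix.mul_assoc]
    · rw [hc, smul_mulVec, dotProduct_smul, smul_eq_mul]
  refine ⟨c, ?_, hN⟩
  have hd := congrArg Matrix.det hN
  rw [det_mul, det_mul, det_transpose, det_smul, Fintype.card_fin] at hd
  have hA2 : A.det * A.det = 1 := by rcases hdet with h | h <;> simp [h]
  have hcn : c ^ (n + 1) = 1 := mul_right_cancel₀ hM (by linear_combination M.det * hA2 - hd)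
  have habs : |c| = 1 := by
    rw [← pow_eq_one_iff_of_nonneg (abs_nonneg c) n.succ_ne_zero, ← abs_pow, hcn, abs_one]
  exact eq_or_eq_neg_of_abs_eq habs

theorem invariant_of_transpose_mul_mul_eq {n : ℕ} {A M : Matrix (Fin (n + 1)) (Fin (n + 1)) ℝ}
    {ε : ℝ} (h : Aᵀ * M * A = ε • M) {X : Fin n → ℝ} (hX : lhom X ⬝ᵥ M *ᵥ lhom X = 0)
    (hlast : (A *ᵥ lhom X) (Fin.last n) ≠ 0) :
    lhom (Fmap A X) ⬝ᵥ M *ᵥ lhom (Fmap A X) = 0 := by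
  rw [Fmap, ← quadratic_smul_eq_zero_iff M hlast, smul_lhom_qmap hlast, quadratic_mulVec, h,
    smul_mulVec, dotProduct_smul, hX, smul_zero]

theorem stmt_5 {n : ℕ} (hn : 2 ≤ n) (A M : Matrix (Fin (n + 1)) (Fin (n + 1)) ℝ)
    (hdet : A.det = 1 ∨ A.det = -1)
    (hMinv : M.det ≠ 0) (hsymm : M.IsSymm)
    -- `M` is indefinite
    (hindef : (∃ v : Fin (n + 1) → ℝ, 0 < v ⬝ᵥ M.mulVec v) ∧
              (∃ w : Fin (n + 1) → ℝ, w ⬝ᵥ M.mulVec w < 0)) :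
    -- `Q(M)` is `F`-invariant iff `AᵀMA = εM` for some `ε ∈ {1,-1}` …
    ((∀ X : Fin n → ℝ, lhom X ⬝ᵥ M.mulVec (lhom X) = 0 →
        A.mulVec (lhom X) (Fin.last n) ≠ 0 →
        lhom (Fmap A X) ⬝ᵥ M.mulVec (lhom (Fmap A X)) = 0) ↔
      ∃ ε : ℝ, (ε = 1 ∨ ε = -1) ∧ Aᵀ * M * A = ε • M) ∧
    -- … and in that case `Aᵀ = ε M A⁻¹ M⁻¹`, so `A` is similar to `ε A⁻¹`.
    (∀ ε : ℝ, (ε = 1 ∨ ε = -1) → Aᵀ * M * A = ε • M →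
      Aᵀ = ε • (M * A⁻¹ * M⁻¹) ∧
      ∃ P : Matrix (Fin (n + 1)) (Fin (n + 1)) ℝ, IsUnit P ∧ P * A * P⁻¹ = ε • A⁻¹) := by
  have hA : IsUnit A.det := by rcases hdet with h | h <;> simp [h]
  have hM : IsUnit M.det := hMinv.isUnit
  refine ⟨⟨exists_sign_of_invariant hn hdet hMinv hsymm hindef.1 hindef.2, ?_⟩, ?_⟩
  · rintro ⟨ε, -, hε⟩ X hX hlast
    exact invariant_of_transpose_mul_mul_eq hε hX hlast
  · intro ε _ h
    have hT : Aᵀ = ε • (M * A⁻¹ * M⁻¹) := by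
      calc Aᵀ = Aᵀ * M * A * A⁻¹ * M⁻¹ := by
            rw [mul_nonsing_inv_cancel_right _ _ hA, mul_nonsing_inv_cancel_right _ _ hM]
        _ = ε • (M * A⁻¹ * M⁻¹) := by simp [h]
    refine ⟨hT, ?_⟩
    obtain ⟨S, hS, hAS⟩ := A.exists_isUnit_transpose_mul_eq
    have hSdet := (Matrix.isUnit_iff_isUnit_det S).1 hS
    refine ⟨M⁻¹ * S, ((Matrix.isUnit_nonsing_inv_iff).2
      ((Matrix.isUnit_iff_isUnit_det M).2 hM)).mul hS, ?_⟩
    calc M⁻¹ * S * A * (M⁻¹ * S)⁻¹ = M⁻¹ * (Aᵀ * S * S⁻¹) * M := by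
          rw [hAS, Matrix.mul_inv_rev, nonsing_inv_nonsing_inv _ hM]
          simp only [Matrix.mul_assoc]
      _ = M⁻¹ * (ε • (M * A⁻¹ * M⁻¹)) * M := by
          rw [mul_nonsing_inv_cancel_right _ _ hSdet, hT]
      _ = ε • A⁻¹ := by
          rw [Matrix.mul_smul, Matrix.smul_mul, Matrix.mul_assoc M,
            nonsing_inv_mul_cancel_left _ _ hM, nonsing_inv_mul_cancel_right _ _ hM]
end

section
/- Let ε ∈ {1,−1} and A ∈ ℝ^{(n+1)×(n+1)}. If there exists an invertible symmetric matrix M₀ ∈ ℝ^{(n+1)×(n+1)} with AᵀM₀A = εM₀, then C_ε(A) = {M ∈ ℝ^{(n+1)×(n+1)} : M = Mᵀ and AᵀMA = εM}; in other words, every symmetric (possibly singular) solution M of AᵀMA = εM is a real linear combination of invertible symmetric solutions. -/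
open Matrix

/-- `C_ε(A)`: the real linear span of the invertible symmetric solutions `M`
of `AᵀMA = εM`. -/
def Cspan {n : ℕ} (ε : ℝ) (A : Matrix (Fin (n + 1)) (Fin (n + 1)) ℝ) :
    Submodule ℝ (Matrix (Fin (n + 1)) (Fin (n + 1)) ℝ) :=
  Submodule.span ℝ
    {M : Matrix (Fin (n + 1)) (Fin (n + 1)) ℝ | M.det ≠ 0 ∧ M.IsSymm ∧ Aᵀ * M * A = ε • M}

/-- An invertible matrix stays invertible under a small nonzero perturbation in any direction. -/
lemma Matrix.exists_ne_zero_det_add_smul_ne_zero {ι : Type*} [Fintype ι] [DecidableEq ι]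
    {M₀ : Matrix ι ι ℝ} (h₀ : M₀.det ≠ 0) (M : Matrix ι ι ℝ) :
    ∃ t : ℝ, t ≠ 0 ∧ (M₀ + t • M).det ≠ 0 := by
  have hc : Continuous fun t : ℝ => (M₀ + t • M).det := by fun_prop
  have hev : ∀ᶠ t in nhds (0 : ℝ), (M₀ + t • M).det ≠ 0 :=
    hc.continuousAt.eventually_ne (by simpa using h₀)
  obtain ⟨t, ht, ht0⟩ :=
    ((hev.filter_mono nhdsWithin_le_nhds).and (self_mem_nhdsWithin (s := {0}ᶜ))).exists
  exact ⟨t, ht0, ht⟩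

/-- A space of real matrices containing an invertible one is spanned by its invertible elements. -/
lemma Submodule.span_det_ne_zero_eq {ι : Type*} [Fintype ι] [DecidableEq ι]
    (S : Submodule ℝ (Matrix ι ι ℝ)) (h : ∃ M₀ ∈ S, M₀.det ≠ 0) :
    Submodule.span ℝ {M | M.det ≠ 0 ∧ M ∈ S} = S := by
  refine le_antisymm (Submodule.span_le.2 fun M hM => hM.2) fun M hM => ?_
  obtain ⟨M₀, hM₀, hdet₀⟩ := h
  obtain ⟨t, ht, hdet⟩ := Matrix.exists_ne_zero_det_add_smul_ne_zero hdet₀ M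
  have key : M = t⁻¹ • ((M₀ + t • M) - M₀) := by
    rw [add_sub_cancel_left, inv_smul_smul₀ ht]
  rw [key]
  exact Submodule.smul_mem _ _ (Submodule.sub_mem _
    (Submodule.subset_span ⟨hdet, S.add_mem hM₀ (S.smul_mem t hM)⟩)
    (Submodule.subset_span ⟨hdet₀, hM₀⟩))

/-- The space of symmetric solutions `M` of `AᵀMA = εM`. -/
def symmSolutions {ι : Type*} [Fintype ι] (ε : ℝ) (A : Matrix ι ι ℝ) :
    Submodule ℝ (Matrix ι ι ℝ) where
  carrier := {M | M.IsSymm ∧ Aᵀ * M * A = ε • M}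
  zero_mem' := ⟨Matrix.isSymm_zero, by simp⟩
  add_mem' hM hN := ⟨hM.1.add hN.1, by rw [mul_add, add_mul, hM.2, hN.2, smul_add]⟩
  smul_mem' t M hM :=
    ⟨hM.1.smul t, by rw [Matrix.mul_smul, Matrix.smul_mul, hM.2, smul_comm]⟩

theorem stmt_7 {n : ℕ} (ε : ℝ) (hε : ε = 1 ∨ ε = -1)
    (A : Matrix (Fin (n + 1)) (Fin (n + 1)) ℝ)
    (h : ∃ M₀ : Matrix (Fin (n + 1)) (Fin (n + 1)) ℝ,
        M₀.det ≠ 0 ∧ M₀.IsSymm ∧ Aᵀ * M₀ * A = ε • M₀) :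
    (Cspan ε A : Set (Matrix (Fin (n + 1)) (Fin (n + 1)) ℝ)) =
      {M : Matrix (Fin (n + 1)) (Fin (n + 1)) ℝ | M.IsSymm ∧ Aᵀ * M * A = ε • M} := by
  obtain ⟨M₀, hdet, hM₀⟩ := h
  exact congrArg SetLike.coe
    (Submodule.span_det_ne_zero_eq (symmSolutions ε A) ⟨M₀, hM₀, hdet⟩)
end

section
/- Let ε ∈ {1,−1} and A ∈ ℝ^{(n+1)×(n+1)}. Then C_ε(A) ≠ {0} if and only if there exists an invertible complex symmetric matrix N₀ ∈ ℂ^{(n+1)×(n+1)} with AᵀN₀A = εN₀; and in that case, the real dimension of C_ε(A) equals the complex dimension of the space {N ∈ ℂ^{(n+1)×(n+1)} : N = Nᵀ, AᵀNA = εN}. -/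
open Matrix

/-- The complex vector space `{N ∈ ℂ^{(n+1)×(n+1)} : N = Nᵀ, AᵀNA = εN}`. -/
noncomputable def CsolC {n : ℕ} (ε : ℝ) (A : Matrix (Fin (n + 1)) (Fin (n + 1)) ℝ) :
    Submodule ℂ (Matrix (Fin (n + 1)) (Fin (n + 1)) ℂ) where
  carrier := {N : Matrix (Fin (n + 1)) (Fin (n + 1)) ℂ | N.IsSymm ∧
    (A.map (Complex.ofReal))ᵀ * N * A.map (Complex.ofReal) = (ε : ℂ) • N}
  zero_mem' := by
    constructor
    · simp [Matrix.IsSymm]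
    · simp
  add_mem' := by
    rintro a b ⟨ha1, ha2⟩ ⟨hb1, hb2⟩
    constructor
    · show (a + b)ᵀ = a + b
      rw [Matrix.transpose_add, ha1, hb1]
    · show (A.map (Complex.ofReal))ᵀ * (a + b) * A.map (Complex.ofReal) = (ε : ℂ) • (a + b)
      rw [Matrix.mul_add, Matrix.add_mul, ha2, hb2, smul_add]
  smul_mem' := by
    rintro c N ⟨h1, h2⟩
    constructor
    · show (c • N)ᵀ = c • N
      rw [Matrix.transpose_smul, h1]
    · show (A.map (Complex.ofReal))ᵀ * (c • N) * A.map (Complex.ofReal) = (ε : ℂ) • (c • N)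
      rw [Matrix.mul_smul, Matrix.smul_mul, h2, smul_comm]

/-- The real vector space of symmetric solutions `M` of `AᵀMA = εM`. -/
def realSol {n : ℕ} (ε : ℝ) (A : Matrix (Fin (n + 1)) (Fin (n + 1)) ℝ) :
    Submodule ℝ (Matrix (Fin (n + 1)) (Fin (n + 1)) ℝ) where
  carrier := {M | M.IsSymm ∧ Aᵀ * M * A = ε • M}
  zero_mem' := by simp [Matrix.IsSymm]
  add_mem' := by
    rintro a b ⟨ha1, ha2⟩ ⟨hb1, hb2⟩
    refine ⟨ha1.add hb1, ?_⟩
    rw [Matrix.mul_add, Matrix.add_mul, ha2, hb2, smul_add]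
  smul_mem' := by
    rintro c N ⟨h1, h2⟩
    refine ⟨h1.smul c, ?_⟩
    rw [Matrix.mul_smul, Matrix.smul_mul, h2, smul_comm]

/-- A real matrix pencil that is nonsingular at some complex parameter is nonsingular at some
nonzero real parameter. -/
theorem exists_real_det_add_smul_ne_zero {m : Type*} [Fintype m] [DecidableEq m]
    (X Y : Matrix m m ℝ) (z : ℂ)
    (h : (X.map Complex.ofReal + z • Y.map Complex.ofReal).det ≠ 0) :
    ∃ t : ℝ, t ≠ 0 ∧ (X + t • Y).det ≠ 0 := by
  set p : Polynomial ℝ := (X.map Polynomial.C + (Polynomial.X : Polynomial ℝ) • Y.map Polynomial.C).det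
    with hp
  have hC : Polynomial.aeval z p = (X.map Complex.ofReal + z • Y.map Complex.ofReal).det := by
    rw [hp, AlgHom.map_det]
    congr 1
    ext i j
    simpa using mul_comm _ z
  have hR (t : ℝ) : p.eval t = (X + t • Y).det := by
    rw [hp, ← Polynomial.coe_evalRingHom, RingHom.map_det]
    congr 1
    ext i j
    simpa using mul_comm _ t
  have hp0 : p ≠ 0 := by
    intro h0
    apply h
    rw [← hC, h0, map_zero]
  obtain ⟨t, ht⟩ := Polynomial.exists_eval_ne_zero_of_natDegree_lt_card (Polynomial.X * p)
    (mul_ne_zero Polynomial.X_ne_zero hp0) (Cardinal.natCast_lt_aleph0.trans_le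
      (Cardinal.aleph0_le_mk ℝ))
  rw [Polynomial.eval_mul, Polynomial.eval_X, hR] at ht
  exact ⟨t, left_ne_zero_of_mul ht, right_ne_zero_of_mul ht⟩

/-- If there is an invertible symmetric solution, the invertible ones span all of them. -/
theorem Cspan_eq_realSol {n : ℕ} {ε : ℝ} {A M₀ : Matrix (Fin (n + 1)) (Fin (n + 1)) ℝ}
    (hdet : M₀.det ≠ 0) (hM₀ : M₀ ∈ realSol ε A) : Cspan ε A = realSol ε A := by
  apply le_antisymm
  · exact Submodule.span_le.2 fun M hM => hM.2
  · intro M hM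
    obtain ⟨t, ht, hd⟩ := exists_real_det_add_smul_ne_zero M₀ M 0 (by
      rw [zero_smul, add_zero]
      have := RingHom.map_det Complex.ofRealHom M₀
      change _ = (M₀.map Complex.ofReal).det at this
      rw [← this]
      simpa using hdet)
    have h1 : M₀ + t • M ∈ Cspan ε A :=
      Submodule.subset_span ⟨hd, (realSol ε A).add_mem hM₀ ((realSol ε A).smul_mem t hM)⟩
    have h2 : M₀ ∈ Cspan ε A := Submodule.subset_span ⟨hdet, hM₀⟩
    have h3 := (Cspan ε A).smul_mem t⁻¹ ((Cspan ε A).sub_mem h1 h2)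
    rwa [add_sub_cancel_left, smul_smul, inv_mul_cancel₀ ht, one_smul] at h3

theorem exists_mem_realSol_of_Cspan_ne_bot {n : ℕ} {ε : ℝ}
    {A : Matrix (Fin (n + 1)) (Fin (n + 1)) ℝ} (h : Cspan ε A ≠ ⊥) :
    ∃ M, M.det ≠ 0 ∧ M ∈ realSol ε A := by
  by_contra! hne
  apply h
  rw [Cspan, Submodule.span_eq_bot]
  exact fun M hM => absurd hM.2 (hne M hM.1)

theorem map_ofReal_add_I_smul_mem_CsolC {n : ℕ} {ε : ℝ}
    {A X Y : Matrix (Fin (n + 1)) (Fin (n + 1)) ℝ}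
    (hX : X ∈ realSol ε A) (hY : Y ∈ realSol ε A) :
    X.map Complex.ofReal + Complex.I • Y.map Complex.ofReal ∈ CsolC ε A := by
  have key {M : Matrix (Fin (n + 1)) (Fin (n + 1)) ℝ} (hM : M ∈ realSol ε A) :
      M.map Complex.ofReal ∈ CsolC ε A := by
    refine ⟨hM.1.map _, ?_⟩
    have := congrArg (fun B => B.map Complex.ofRealHom) hM.2
    simp only [Matrix.map_mul] at this
    refine Eq.trans this ?_
    ext i j
    simp
  exact (CsolC ε A).add_mem (key hX) ((CsolC ε A).smul_mem _ (key hY))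

theorem re_im_mem_realSol {n : ℕ} {ε : ℝ} {A : Matrix (Fin (n + 1)) (Fin (n + 1)) ℝ}
    {N : Matrix (Fin (n + 1)) (Fin (n + 1)) ℂ} (hN : N ∈ CsolC ε A) :
    N.map Complex.re ∈ realSol ε A ∧ N.map Complex.im ∈ realSol ε A := by
  refine ⟨⟨hN.1.map _, ?_⟩, ⟨hN.1.map _, ?_⟩⟩ <;> ext i j
  · have := congrArg Complex.re (congrFun₂ hN.2 i j)
    simpa [Matrix.mul_apply] using this
  · have := congrArg Complex.im (congrFun₂ hN.2 i j)
    simpa [Matrix.mul_apply] using this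

theorem map_re_add_I_smul_map_im {m : Type*} (N : Matrix m m ℂ) :
    (N.map Complex.re).map Complex.ofReal + Complex.I • (N.map Complex.im).map Complex.ofReal
      = N := by
  ext i j
  simp [mul_comm Complex.I, Complex.re_add_im]

/-- The decomposition of a complex solution into its real and imaginary parts. -/
noncomputable def CsolCEquiv {n : ℕ} (ε : ℝ) (A : Matrix (Fin (n + 1)) (Fin (n + 1)) ℝ) :
    CsolC ε A ≃ₗ[ℝ] realSol ε A × realSol ε A where
  toFun N := (⟨_, (re_im_mem_realSol N.2).1⟩, ⟨_, (re_im_mem_realSol N.2).2⟩)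
  map_add' N N' := by ext i j <;> simp
  map_smul' c N := by ext i j <;> simp
  invFun P := ⟨_, map_ofReal_add_I_smul_mem_CsolC P.1.2 P.2.2⟩
  left_inv N := Subtype.ext (map_re_add_I_smul_map_im N.1)
  right_inv P := by ext i j <;> simp

theorem finrank_realSol {n : ℕ} (ε : ℝ) (A : Matrix (Fin (n + 1)) (Fin (n + 1)) ℝ) :
    Module.finrank ℝ (realSol ε A) = Module.finrank ℂ (CsolC ε A) := by
  have h1 := (CsolCEquiv ε A).finrank_eq
  rw [Module.finrank_prod, finrank_real_of_complex] at h1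
  omega

theorem stmt_8 {n : ℕ} (ε : ℝ) (hε : ε = 1 ∨ ε = -1)
    (A : Matrix (Fin (n + 1)) (Fin (n + 1)) ℝ) :
    (Cspan ε A ≠ ⊥ ↔
      ∃ N₀ : Matrix (Fin (n + 1)) (Fin (n + 1)) ℂ, N₀.det ≠ 0 ∧ N₀.IsSymm ∧
        (A.map (Complex.ofReal))ᵀ * N₀ * A.map (Complex.ofReal) = (ε : ℂ) • N₀) ∧
    (Cspan ε A ≠ ⊥ →
      Module.finrank ℝ (Cspan ε A) = Module.finrank ℂ (CsolC ε A)) := by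
  refine ⟨⟨fun h => ?_, ?_⟩, fun h => ?_⟩
  · obtain ⟨M, hd, hM⟩ := exists_mem_realSol_of_Cspan_ne_bot h
    have hmem := map_ofReal_add_I_smul_mem_CsolC hM (realSol ε A).zero_mem
    rw [Matrix.map_zero _ Complex.ofReal_zero, smul_zero, add_zero] at hmem
    refine ⟨M.map Complex.ofReal, ?_, hmem⟩
    have := RingHom.map_det Complex.ofRealHom M
    change _ = (M.map Complex.ofReal).det at this
    rw [← this]
    simpa using hd
  · rintro ⟨N, hd, hN⟩
    obtain ⟨hX, hY⟩ := re_im_mem_realSol (N := N) hN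
    rw [← map_re_add_I_smul_map_im N] at hd
    obtain ⟨t, -, ht⟩ := exists_real_det_add_smul_ne_zero _ _ _ hd
    have hmem : N.map Complex.re + t • N.map Complex.im ∈ Cspan ε A :=
      Submodule.subset_span ⟨ht, (realSol ε A).add_mem hX ((realSol ε A).smul_mem t hY)⟩
    intro hbot
    rw [hbot, Submodule.mem_bot] at hmem
    rw [hmem] at ht
    exact ht (Matrix.det_zero)
  · obtain ⟨M, hd, hM⟩ := exists_mem_realSol_of_Cspan_ne_bot h
    rw [Cspan_eq_realSol hd hM, finrank_realSol]
end

section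
/- Let ε ∈ {1,−1} and let A = diag(A₁, A₂) be block diagonal, where A₁ ∈ ℂ^{p×p} and A₂ ∈ ℂ^{q×q} are invertible complex matrices such that no eigenvalue λ of A₁ and eigenvalue μ of A₂ satisfy λμ = ε (equivalently, the spectra of A₁ and of εA₂⁻¹ are disjoint). Then a complex matrix R ∈ ℂ^{(p+q)×(p+q)}, written in blocks R = [[R₁, R₃],[R₄, R₂]] with R₁ ∈ ℂ^{p×p} and R₂ ∈ ℂ^{q×q}, satisfies AᵀRA = εR if and only if R₃ = 0, R₄ = 0, A₁ᵀR₁A₁ = εR₁ and A₂ᵀR₂A₂ = εR₂. -/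
open Matrix

open Polynomial in
/-- A matrix intertwining `B` and `D` intertwines every polynomial in `B` and `D`. -/
theorem Matrix.aeval_mul_eq_mul_aeval {m n K : Type*} [Fintype m] [DecidableEq m] [Fintype n]
    [DecidableEq n] [CommRing K] {B : Matrix m m K} {D : Matrix n n K} {X : Matrix m n K}
    (h : B * X = X * D) (P : K[X]) : aeval B P * X = X * aeval D P := by
  induction P using Polynomial.induction_on' with
  | add f g hf hg => simp [Matrix.add_mul, Matrix.mul_add, hf, hg]
  | monomial k a =>
    have hk : B ^ k * X = X * D ^ k := by
      induction k with
      | zero => simp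
      | succ k ih => rw [pow_succ, Matrix.mul_assoc, h, ← Matrix.mul_assoc, ih, Matrix.mul_assoc,
          ← pow_succ]
    simp [aeval_monomial, Algebra.algebraMap_eq_smul_one, hk]

/-- Uniqueness in Sylvester's theorem: only the zero matrix intertwines matrices with disjoint
spectra. -/
theorem Matrix.eq_zero_of_mul_eq_mul_of_disjoint_spectrum {m n K : Type*} [Fintype m]
    [DecidableEq m] [Fintype n] [DecidableEq n] [Field K] [IsAlgClosed K]
    {B : Matrix m m K} {D : Matrix n n K} {X : Matrix m n K} (h : B * X = X * D)
    (hBD : Disjoint (spectrum K B) (spectrum K D)) : X = 0 := by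
  cases isEmpty_or_nonempty m
  · exact Subsingleton.elim _ _
  have hP : X * Polynomial.aeval D B.charpoly = 0 := by
    rw [← aeval_mul_eq_mul_aeval h, aeval_self_charpoly, Matrix.zero_mul]
  have hdeg : 0 < B.charpoly.degree := by
    rw [charpoly_degree_eq_dim]
    exact_mod_cast Fintype.card_pos
  have hu : IsUnit (Polynomial.aeval D B.charpoly) := by
    rw [← spectrum.zero_notMem_iff K, spectrum.map_polynomial_aeval_of_degree_pos D _ hdeg]
    rintro ⟨μ, hμ, h0⟩
    exact Set.disjoint_left.mp hBD (mem_spectrum_iff_isRoot_charpoly.mpr h0) hμ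
  obtain ⟨u, hu⟩ := hu
  calc X = X * (u : Matrix n n K) * (↑u⁻¹ : Matrix n n K) := by
        rw [Matrix.mul_assoc, Units.mul_inv, Matrix.mul_one]
    _ = 0 := by rw [hu, hP, Matrix.zero_mul]

/-- The Stein equation `Bᵀ X C = ε X` has only the zero solution if `ε` is not a product of an
eigenvalue of `B` and one of `C`. -/
theorem Matrix.eq_zero_of_transpose_mul_mul_eq_smul {m n K : Type*} [Fintype m]
    [DecidableEq m] [Fintype n] [DecidableEq n] [Field K] [IsAlgClosed K]
    {B : Matrix m m K} {C : Matrix n n K} {X : Matrix m n K} {ε : K} (hε : ε ≠ 0)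
    (hC : IsUnit C) (hspec : ∀ b ∈ spectrum K B, ∀ c ∈ spectrum K C, b * c ≠ ε)
    (h : Bᵀ * X * C = ε • X) : X = 0 := by
  obtain ⟨u, rfl⟩ := hC
  refine eq_zero_of_mul_eq_mul_of_disjoint_spectrum (B := Bᵀ)
    (D := ε • (↑u⁻¹ : Matrix n n K)) ?_ ?_
  · rw [Matrix.mul_smul, ← Matrix.smul_mul, ← h, Matrix.mul_assoc _ (u : Matrix n n K),
      Units.mul_inv, Matrix.mul_one]
  · rw [Set.disjoint_left]
    intro b hb hbD
    rw [mem_spectrum_iff_isRoot_charpoly, charpoly_transpose,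
      ← mem_spectrum_iff_isRoot_charpoly] at hb
    obtain ⟨e, rfl⟩ := hε.isUnit
    have hb' : (↑e⁻¹ : K) * b ∈ spectrum K (↑u⁻¹ : Matrix n n K) := by
      rw [← spectrum.smul_mem_smul_iff (r := e)]
      have : e • ((↑e⁻¹ : K) * b) = b := by simp [Units.smul_def]
      rw [this]
      exact hbD
    have hb0 : b ≠ 0 := by
      rintro rfl
      rw [mul_zero] at hb'
      exact spectrum.zero_notMem K u⁻¹.isUnit hb'
    lift b to Kˣ using hb0.isUnit
    have hc : ((e⁻¹ * b)⁻¹ : Kˣ).val ∈ spectrum K (u : Matrix n n K) := by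
      rw [spectrum.inv_mem_iff, inv_inv]
      simpa using hb'
    exact hspec _ hb _ hc (by simp)

open Matrix

theorem stmt_9 {p q : ℕ} (ε : ℂ) (hε : ε = 1 ∨ ε = -1)
    (A₁ : Matrix (Fin p) (Fin p) ℂ) (A₂ : Matrix (Fin q) (Fin q) ℂ)
    (hA₁ : IsUnit A₁) (hA₂ : IsUnit A₂)
    -- no eigenvalue `λ` of `A₁` and eigenvalue `μ` of `A₂` satisfy `λμ = ε`
    (hspec : ∀ lam mu : ℂ, lam ∈ spectrum ℂ A₁ → mu ∈ spectrum ℂ A₂ → lam * mu ≠ ε)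
    (R₁ : Matrix (Fin p) (Fin p) ℂ) (R₂ : Matrix (Fin q) (Fin q) ℂ)
    (R₃ : Matrix (Fin p) (Fin q) ℂ) (R₄ : Matrix (Fin q) (Fin p) ℂ) :
    (Matrix.fromBlocks A₁ 0 0 A₂)ᵀ * Matrix.fromBlocks R₁ R₃ R₄ R₂ *
        Matrix.fromBlocks A₁ 0 0 A₂ = ε • Matrix.fromBlocks R₁ R₃ R₄ R₂ ↔
      R₃ = 0 ∧ R₄ = 0 ∧ A₁ᵀ * R₁ * A₁ = ε • R₁ ∧ A₂ᵀ * R₂ * A₂ = ε • R₂ := by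
  have hε0 : ε ≠ 0 := by rcases hε with rfl | rfl <;> simp
  rw [fromBlocks_transpose, fromBlocks_multiply, fromBlocks_multiply, fromBlocks_smul,
    fromBlocks_inj]
  simp only [transpose_zero, Matrix.zero_mul, Matrix.mul_zero, add_zero, zero_add]
  constructor
  · rintro ⟨h₁, h₃, h₄, h₂⟩
    exact ⟨eq_zero_of_transpose_mul_mul_eq_smul hε0 hA₂
        (fun b hb c hc => hspec b c hb hc) h₃,
      eq_zero_of_transpose_mul_mul_eq_smul hε0 hA₁
        (fun b hb c hc => mul_comm b c ▸ hspec c b hc hb) h₄, h₁, h₂⟩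
  · rintro ⟨rfl, rfl, h₁, h₂⟩
    simp [h₁, h₂]
end

section
/- Let ε ∈ {1,−1}, let λ ∈ ℂ satisfy λ ≠ 0 and λ² ≠ ε, and let A = diag(λI_m, ελ⁻¹I_m) ∈ ℂ^{2m×2m}. Then a symmetric matrix R = Rᵀ ∈ ℂ^{2m×2m} satisfies AᵀRA = εR if and only if R has block form [[0, B],[Bᵀ, 0]] for some B ∈ ℂ^{m×m}. -/
open Matrix

theorem stmt_10 {m : ℕ} (ε : ℂ) (hε : ε = 1 ∨ ε = -1)
    (lam : ℂ) (hlam0 : lam ≠ 0) (hlam : lam ^ 2 ≠ ε)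
    (R : Matrix (Fin m ⊕ Fin m) (Fin m ⊕ Fin m) ℂ) (hR : R.IsSymm) :
    (Matrix.fromBlocks (lam • (1 : Matrix (Fin m) (Fin m) ℂ)) 0 0
          ((ε * lam⁻¹) • (1 : Matrix (Fin m) (Fin m) ℂ)))ᵀ * R *
        Matrix.fromBlocks (lam • (1 : Matrix (Fin m) (Fin m) ℂ)) 0 0
          ((ε * lam⁻¹) • (1 : Matrix (Fin m) (Fin m) ℂ)) = ε • R ↔
      ∃ B : Matrix (Fin m) (Fin m) ℂ, R = Matrix.fromBlocks 0 B Bᵀ 0 := by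
  have hεε : ε * ε = 1 := by rcases hε with rfl | rfl <;> norm_num
  have hP : lam * lam - ε ≠ 0 := fun h => hlam (by linear_combination h)
  have hS : ε * lam⁻¹ * (ε * lam⁻¹) - ε ≠ 0 := by
    intro h
    apply hlam
    field_simp at h
    linear_combination -ε * h + (ε - lam ^ 2) * hεε
  have hoff : lam * (ε * lam⁻¹) = ε := by field_simp
  obtain ⟨P, Q, Q', S, rfl⟩ : ∃ P Q Q' S, R = fromBlocks P Q Q' S :=
    ⟨_, _, _, _, (fromBlocks_toBlocks R).symm⟩
  obtain ⟨-, hQ, -, -⟩ := isSymm_fromBlocks_iff.mp hR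
  subst hQ
  simp only [fromBlocks_transpose, fromBlocks_multiply, fromBlocks_smul, fromBlocks_inj,
    transpose_smul, transpose_one, transpose_zero, Matrix.smul_mul, Matrix.mul_smul,
    Matrix.one_mul, Matrix.mul_one, Matrix.zero_mul, Matrix.mul_zero, add_zero, zero_add,
    smul_smul]
  constructor
  · rintro ⟨h₁, -, -, h₄⟩
    rw [← sub_eq_zero, ← sub_smul] at h₁ h₄
    exact ⟨Q, (smul_eq_zero.mp h₁).resolve_left hP, rfl, rfl,
      (smul_eq_zero.mp h₄).resolve_left hS⟩
  · rintro ⟨B, rfl, -, -, rfl⟩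
    simp only [smul_zero, hoff, mul_comm (ε * lam⁻¹) lam, and_self]
end

section
/- Let ε ∈ {1,−1} and let A ∈ ℝ^{(n+1)×(n+1)} be an invertible semisimple matrix such that A is similar to εA⁻¹ (i.e. there exists an invertible real matrix Q with QAQ⁻¹ = εA⁻¹). Then there exists an invertible symmetric matrix M ∈ ℝ^{(n+1)×(n+1)} with AᵀMA = εM. -/
open Matrix

/-- If `d i * d (σ i) = e` for a permutation `σ`, then `σ` can be replaced by an involution. -/
theorem exists_involutive_mul_eq {ι K : Type*} [Field K] {d : ι → K} {e : K}
    (hd : ∀ i, d i ≠ 0) (σ : Equiv.Perm ι) (hσ : ∀ i, d i * d (σ i) = e) :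
    ∃ τ : ι → ι, Function.Involutive τ ∧ ∀ i, d i * d (τ i) = e := by
  classical
  have hσ' : ∀ i, d i * d (σ.symm i) = e := fun i => by
    simpa [mul_comm] using hσ (σ.symm i)
  have hs : ∀ i, d (σ i) = e / d i := fun i => by
    rw [eq_div_iff (hd i), mul_comm, hσ]
  have hs' : ∀ i, d (σ.symm i) = e / d i := fun i => by
    rw [eq_div_iff (hd i), mul_comm, hσ']
  have hdd : ∀ i, e / (e / d i) = d i := fun i => by
    have he : e ≠ 0 := by
      rw [← hσ i]
      exact mul_ne_zero (hd i) (hd _)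
    field_simp
  let r : K → K → Prop := WellOrderingRel
  have hasymm : ∀ a b, r a b → ¬ r b a := fun a b h h' => asymm_of WellOrderingRel h h'
  have htri : ∀ a b, r a b ∨ a = b ∨ r b a := fun a b => trichotomous_of WellOrderingRel a b
  refine ⟨fun i => if r (d i) (e / d i) then σ i else
    if r (e / d i) (d i) then σ.symm i else i, fun i => ?_, fun i => ?_⟩
  · by_cases h : r (d i) (e / d i)
    · simp [h, hs, hdd, hasymm _ _ h]
    · by_cases h' : r (e / d i) (d i)
      · simp [h, h', hs', hdd]
      · simp [h, h']
  · by_cases h : r (d i) (e / d i)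
    · simp [h, hσ]
    · by_cases h' : r (e / d i) (d i)
      · simp [h, h', hσ']
      · have hi : d i = e / d i := by
          rcases htri (d i) (e / d i) with h₁ | h₁ | h₁
          exacts [absurd h₁ h, h₁, absurd h₁ h']
        simp only [h, h', if_false]
        rwa [eq_div_iff (hd i)] at hi

/-- If an invertible matrix `R` satisfies `D * R * D = e • R` with `D` diagonal and invertible,
then `R` can be replaced by a symmetric invertible matrix. -/
theorem exists_isSymm_diagonal_mul_mul_diagonal {ι K : Type*} [Fintype ι] [DecidableEq ι] [Field K]
    {d : ι → K} {e : K} (hd : ∀ i, d i ≠ 0) {R : Matrix ι ι K} (hR : R.det ≠ 0)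
    (h : diagonal d * R * diagonal d = e • R) :
    ∃ S : Matrix ι ι K, S.det ≠ 0 ∧ S.IsSymm ∧ diagonal d * S * diagonal d = e • S := by
  obtain ⟨σ, hσ⟩ : ∃ σ : Equiv.Perm ι, ∀ i, R (σ i) i ≠ 0 := by
    rw [det_apply] at hR
    obtain ⟨σ, -, hσ⟩ := Finset.exists_ne_zero_of_sum_ne_zero hR
    refine ⟨σ, fun i hi => hσ ?_⟩
    have h0 : ∏ j, R (σ j) j = 0 := Finset.prod_eq_zero (Finset.mem_univ i) hi
    rw [h0, smul_zero]
  obtain ⟨τ, hτ, hdτ⟩ := exists_involutive_mul_eq hd σ (e := e) fun i => by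
    have hi := congrFun (congrFun h (σ i)) i
    simp only [mul_diagonal, diagonal_mul, Matrix.smul_apply, smul_eq_mul] at hi
    refine mul_right_cancel₀ (hσ i) ?_
    rw [← hi]
    ring
  refine ⟨of fun i j => if τ i = j then 1 else 0, ?_, ?_, ?_⟩
  · refine det_ne_zero_of_right_inverse (B := of fun i j => if τ i = j then 1 else 0) ?_
    ext i j
    simp only [mul_apply, of_apply, one_apply, ite_mul, one_mul, zero_mul, Finset.sum_ite_eq,
      Finset.mem_univ, if_true, hτ i]
  · ext i j
    simp only [transpose_apply, of_apply]
    congr 1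
    rw [eq_iff_iff, hτ.eq_iff, eq_comm]
  · ext i j
    simp only [mul_diagonal, diagonal_mul, Matrix.smul_apply, smul_eq_mul, of_apply]
    split_ifs with hij
    · rw [← hij, mul_one, mul_one, hdτ]
    · simp

/-- If some complex combination `M + i N` of real matrices is invertible, so is some real one. -/
theorem exists_det_add_smul_ne_zero {ι : Type*} [Fintype ι] [DecidableEq ι] (M N : Matrix ι ι ℝ)
    (h : (M.map Complex.ofReal + Complex.I • N.map Complex.ofReal).det ≠ 0) :
    ∃ t : ℝ, (M + t • N).det ≠ 0 := by
  let p : Polynomial ℝ :=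
    (M.map Polynomial.C + (Polynomial.X : Polynomial ℝ) • N.map Polynomial.C).det
  have hp : p ≠ 0 := by
    intro hp
    apply h
    have := congrArg (Polynomial.aeval Complex.I) hp
    rw [map_zero, AlgHom.map_det] at this
    rw [← this]
    congr 1
    ext i j
    simp [mul_comm Complex.I]
  by_contra! hc
  refine hp (Polynomial.funext fun t => ?_)
  rw [Polynomial.eval_zero, ← hc t, ← Polynomial.coe_evalRingHom, RingHom.map_det]
  congr 1
  ext i j
  simp [mul_comm t]

/-- A linear matrix equation with real coefficients that has an invertible symmetric complex
solution has an invertible symmetric real solution. -/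
theorem exists_real_isSymm_of_complex {ι : Type*} [Fintype ι] [DecidableEq ι] {A : Matrix ι ι ℝ}
    {ε : ℝ} {M : Matrix ι ι ℂ} (hdet : M.det ≠ 0) (hsymm : M.IsSymm)
    (h : (A.map Complex.ofReal)ᵀ * M * A.map Complex.ofReal = (ε : ℂ) • M) :
    ∃ N : Matrix ι ι ℝ, N.det ≠ 0 ∧ N.IsSymm ∧ Aᵀ * N * A = ε • N := by
  have hre : Aᵀ * M.map Complex.re * A = ε • M.map Complex.re := by
    ext i j
    simpa [mul_apply] using congrArg Complex.re (congrFun (congrFun h i) j)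
  have him : Aᵀ * M.map Complex.im * A = ε • M.map Complex.im := by
    ext i j
    simpa [mul_apply] using congrArg Complex.im (congrFun (congrFun h i) j)
  obtain ⟨t, ht⟩ := exists_det_add_smul_ne_zero (M.map Complex.re) (M.map Complex.im) (by
    convert hdet using 2
    ext i j
    simp [mul_comm Complex.I, Complex.re_add_im])
  refine ⟨_, ht, (hsymm.map _).add ((hsymm.map _).smul t), ?_⟩
  rw [Matrix.mul_add, Matrix.add_mul, hre, Matrix.mul_smul, Matrix.smul_mul, him, smul_add,
    smul_comm]

theorem stmt_11 {n : ℕ} (ε : ℝ) (hε : ε = 1 ∨ ε = -1)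
    (A : Matrix (Fin (n + 1)) (Fin (n + 1)) ℝ)
    (hA : IsUnit A)
    -- `A` is semisimple: diagonalizable over `ℂ`
    (hsemi : ∃ P : Matrix (Fin (n + 1)) (Fin (n + 1)) ℂ, IsUnit P ∧
      ∃ d : Fin (n + 1) → ℂ, P * A.map (Complex.ofReal) * P⁻¹ = Matrix.diagonal d)
    -- `A` is similar to `ε A⁻¹`
    (hsim : ∃ Q : Matrix (Fin (n + 1)) (Fin (n + 1)) ℝ, IsUnit Q ∧ Q * A * Q⁻¹ = ε • A⁻¹) :
    ∃ M : Matrix (Fin (n + 1)) (Fin (n + 1)) ℝ,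
      M.det ≠ 0 ∧ M.IsSymm ∧ Aᵀ * M * A = ε • M := by
  obtain ⟨P, hP, d, hPd⟩ := hsemi
  obtain ⟨Q, hQ, hQA⟩ := hsim
  have hAd : IsUnit A.det := (isUnit_iff_isUnit_det A).1 hA
  have hPdet : IsUnit P.det := (isUnit_iff_isUnit_det P).1 hP
  have hQdet : IsUnit Q.det := (isUnit_iff_isUnit_det Q).1 hQ
  have hAQA : A * Q * A = ε • Q := by
    have h₁ : Q * A = ε • A⁻¹ * Q := by rw [← hQA, nonsing_inv_mul_cancel_right _ _ hQdet]
    rw [Matrix.mul_assoc, h₁, Matrix.smul_mul, Matrix.mul_smul, mul_nonsing_inv_cancel_left _ _ hAd]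
  set B := A.map Complex.ofReal with hB
  set C := Q.map Complex.ofReal with hC
  have hBdet : B.det ≠ 0 := by
    have : B.det = (A.det : ℂ) := (RingHom.map_det Complex.ofRealHom A).symm
    rw [this]
    exact_mod_cast hAd.ne_zero
  have hCdet : C.det ≠ 0 := by
    have : C.det = (Q.det : ℂ) := (RingHom.map_det Complex.ofRealHom Q).symm
    rw [this]
    exact_mod_cast hQdet.ne_zero
  have hBCB : B * C * B = (ε : ℂ) • C := by
    ext i j
    have := congrArg Complex.ofReal (congrFun (congrFun hAQA i) j)
    simpa [mul_apply, hB, hC] using this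
  have hPinv : P⁻¹.det ≠ 0 := ((isUnit_nonsing_inv_det_iff).2 hPdet).ne_zero
  have hd : ∀ i, d i ≠ 0 := by
    have : (diagonal d).det ≠ 0 := by
      rw [← hPd, det_mul, det_mul]
      exact mul_ne_zero (mul_ne_zero hPdet.ne_zero hBdet) hPinv
    rw [det_diagonal, Finset.prod_ne_zero_iff] at this
    exact fun i => this i (Finset.mem_univ i)
  have hPB : P * B = diagonal d * P := by
    rw [← hPd, nonsing_inv_mul_cancel_right _ _ hPdet]
  have hBP : B * P⁻¹ = P⁻¹ * diagonal d := by
    rw [← hPd, Matrix.mul_assoc P, nonsing_inv_mul_cancel_left _ _ hPdet]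
  obtain ⟨S, hS, hSs, hSd⟩ := exists_isSymm_diagonal_mul_mul_diagonal (e := (ε : ℂ)) hd
    (R := P * C * P⁻¹)
    (by
      rw [det_mul, det_mul]
      exact mul_ne_zero (mul_ne_zero hPdet.ne_zero hCdet) hPinv)
    (calc
      diagonal d * (P * C * P⁻¹) * diagonal d = (diagonal d * P) * C * (P⁻¹ * diagonal d) := by
        simp only [Matrix.mul_assoc]
      _ = P * (B * C * B) * P⁻¹ := by
        rw [← hPB, ← hBP]
        simp only [Matrix.mul_assoc]
      _ = (ε : ℂ) • (P * C * P⁻¹) := by rw [hBCB, Matrix.mul_smul, Matrix.smul_mul])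
  refine exists_real_isSymm_of_complex (M := Pᵀ * S * P) ?_ ?_ ?_
  · rw [det_mul, det_mul, det_transpose]
    exact mul_ne_zero (mul_ne_zero hPdet.ne_zero hS) hPdet.ne_zero
  · rw [IsSymm, transpose_mul, transpose_mul, transpose_transpose, hSs.eq, Matrix.mul_assoc]
  · calc
      Bᵀ * (Pᵀ * S * P) * B = (P * B)ᵀ * S * (P * B) := by
        simp only [transpose_mul, Matrix.mul_assoc]
      _ = Pᵀ * (diagonal d * S * diagonal d) * P := by
        rw [hPB, transpose_mul, diagonal_transpose]
        simp only [Matrix.mul_assoc]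
      _ = (ε : ℂ) • (Pᵀ * S * P) := by rw [hSd, Matrix.mul_smul, Matrix.smul_mul]
end

section
/- Let ε ∈ {1,−1} and let A ∈ ℝ^{(n+1)×(n+1)} be an invertible semisimple matrix similar to εA⁻¹. Then for every X₀ ∈ ℝ^n, at least one of the following holds: (a) there exists a proper A-invariant linear subspace U ⊊ ℝ^{n+1} with ℓ(X₀) ∈ U (so X₀ lies in a proper F-invariant affine variety), or (b) there exists an invertible symmetric matrix M ∈ ℝ^{(n+1)×(n+1)} with AᵀMA = εM and ℓ(X₀)ᵀMℓ(X₀) = 0 (so the whole orbit of X₀ under F = q ∘ A ∘ ℓ lies in the non-degenerate F-invariant quadric Q(M)). -/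
open Matrix

/-- A nonzero complex left eigenvector orthogonal to a real vector `x` yields a proper real invariant
subspace containing `x`. -/
lemma exists_invariant_submodule_of_left_eigenvector {m : Type*} [Fintype m] [DecidableEq m]
    (A : Matrix m m ℝ) (x : m → ℝ) (v : m → ℂ) (μ : ℂ) (hv : v ≠ 0)
    (hvA : v ᵥ* A.map Complex.ofReal = μ • v) (hx : v ⬝ᵥ (fun i => (x i : ℂ)) = 0) :
    ∃ U : Submodule ℝ (m → ℝ), U ≠ ⊤ ∧ (∀ u ∈ U, A.mulVec u ∈ U) ∧ x ∈ U := by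
  refine ⟨{ carrier := {u | v ⬝ᵥ (fun i => (u i : ℂ)) = 0}
            add_mem' := ?_, zero_mem' := ?_, smul_mem' := ?_ }, ?_, ?_, hx⟩
  · intro a b ha hb
    simp only [Set.mem_ofPred_eq, dotProduct] at *
    simp [mul_add, Finset.sum_add_distrib, ha, hb]
  · simp [dotProduct]
  · intro r a ha
    simp only [Set.mem_ofPred_eq, dotProduct] at *
    simp [mul_left_comm _ (r : ℂ), ← Finset.mul_sum, ha]
  · intro h
    apply hv
    ext i
    have hi : Pi.single i (1 : ℝ) ∈ (⊤ : Submodule ℝ (m → ℝ)) := trivial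
    rw [← h] at hi
    change v ⬝ᵥ (fun j => ((Pi.single i (1 : ℝ) : m → ℝ) j : ℂ)) = 0 at hi
    simpa [dotProduct, Pi.single_apply, apply_ite Complex.ofReal] using hi
  · intro u hu
    change v ⬝ᵥ (fun i => (u i : ℂ)) = 0 at hu
    change v ⬝ᵥ (fun i => ((A.mulVec u) i : ℂ)) = 0
    have h : (fun i => ((A.mulVec u) i : ℂ)) = A.map Complex.ofReal *ᵥ (fun i => (u i : ℂ)) := by
      ext i
      simp [mulVec, dotProduct]
    rw [h, dotProduct_mulVec, hvA, smul_dotProduct, hu, smul_zero]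

/-- A complex pencil `B + I C` of real matrices that is invertible has an invertible real member. -/
lemma exists_real_det_add_smul_ne_zero_s13 {m : Type*} [Fintype m] [DecidableEq m]
    (M : Matrix m m ℂ) (hM : M.det ≠ 0) :
    ∃ t : ℝ, (M.map Complex.re + t • M.map Complex.im).det ≠ 0 := by
  by_contra! h
  let p : Polynomial ℝ := ((M.map Complex.re).map Polynomial.C +
    (Polynomial.X : Polynomial ℝ) • (M.map Complex.im).map Polynomial.C).det
  have hp : p = 0 := by
    apply Polynomial.funext
    intro t
    rw [Polynomial.eval_zero, ← h t, ← Polynomial.coe_evalRingHom, RingHom.map_det]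
    congr 1
    ext i j
    simp [mul_comm t]
  apply hM
  have hI : Polynomial.eval₂RingHom Complex.ofRealHom Complex.I p = 0 := by rw [hp, map_zero]
  rw [← hI, RingHom.map_det]
  congr 1
  ext i j
  simp [Complex.re_add_im]

/-- An involution of a finite type with at least three elements preserves a nowhere vanishing
function with zero sum. -/
lemma exists_invariant_ne_zero_sum_eq_zero {m : Type*} [Fintype m] [DecidableEq m]
    (hm : 3 ≤ Fintype.card m) (τ : m → m) (hτ : Function.Involutive τ) :
    ∃ c : m → ℂ, (∀ i, c (τ i) = c i) ∧ (∀ i, c i ≠ 0) ∧ ∑ i, c i = 0 := by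
  have : Nonempty m := Fintype.card_pos_iff.mp (by omega)
  let a : m := Classical.arbitrary m
  let O : Finset m := {a, τ a}
  have hO : O.card ≤ 2 := Finset.card_le_two
  have hO' : 0 < O.card := Finset.card_pos.mpr ⟨a, by simp [O]⟩
  have hmem : ∀ i, τ i ∈ O ↔ i ∈ O := by
    intro i
    simp only [O, Finset.mem_insert, Finset.mem_singleton, hτ.eq_iff]
    rw [hτ a, or_comm]
  refine ⟨fun i => (O.card : ℂ) - if i ∈ O then (Fintype.card m : ℂ) else 0, ?_, ?_, ?_⟩
  · intro i
    simp only [hmem]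
  · intro i
    simp only
    split_ifs
    · rw [sub_ne_zero]
      exact_mod_cast (by omega : O.card ≠ Fintype.card m)
    · rw [sub_zero]
      exact_mod_cast hO'.ne'
  · rw [Finset.sum_sub_distrib, Finset.sum_ite_mem]
    simp [mul_comm]

/-- An `ε`-isometric complex symmetric form vanishing at a vector with nonzero coordinates, for a
diagonal matrix whose entries are paired by an involution. -/
lemma exists_symm_form_diagonal {m : Type*} [Fintype m] [DecidableEq m]
    (hm : 3 ≤ Fintype.card m) (ε : ℂ) (d y : m → ℂ) (hy : ∀ i, y i ≠ 0)
    (τ : m → m) (hτ : Function.Involutive τ) (hd : ∀ i, d i * d (τ i) = ε) :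
    ∃ K : Matrix m m ℂ, K.det ≠ 0 ∧ K.IsSymm ∧
      diagonal d * K * diagonal d = ε • K ∧ y ⬝ᵥ K *ᵥ y = 0 := by
  obtain ⟨c, hcτ, hc, hsum⟩ := exists_invariant_ne_zero_sum_eq_zero hm τ hτ
  let s : m → ℂ := fun i => c i / (y i * y (τ i))
  have hs : ∀ i, s i ≠ 0 := fun i => div_ne_zero (hc i) (mul_ne_zero (hy _) (hy _))
  have hsτ : ∀ i, s (τ i) = s i := fun i => by simp only [s, hcτ, hτ i, mul_comm]
  let K : Matrix m m ℂ := of fun i j => if j = τ i then s i else 0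
  have hK : ∀ i j, K i j = if j = τ i then s i else 0 := fun _ _ => rfl
  refine ⟨K, ?_, ?_, ?_, ?_⟩
  · have hKK : K * K = diagonal fun i => s i * s i := by
      ext i j
      simp only [mul_apply, hK, diagonal_apply, ite_mul, zero_mul, Finset.sum_ite_eq', Finset.mem_univ,
        if_true]
      simp only [hτ i, hsτ, mul_ite, mul_zero, eq_comm (a := j)]
    intro h
    have hdet := congrArg det hKK
    rw [det_mul, h, zero_mul, det_diagonal] at hdet
    exact Finset.prod_ne_zero_iff.mpr (fun i _ => mul_ne_zero (hs i) (hs i)) hdet.symm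
  · ext i j
    simp only [transpose_apply, hK]
    by_cases h : j = τ i
    · subst h
      simp [hτ i, hsτ]
    · have h' : i ≠ τ j := fun h' => h (by rw [h', hτ j])
      simp [h, h']
  · ext i j
    rw [mul_diagonal, diagonal_mul, Matrix.smul_apply, hK, smul_eq_mul]
    split_ifs with h
    · rw [h, ← hd i]
      ring
    · simp
  · rw [← hsum]
    simp only [dotProduct, mulVec, hK, ite_mul, zero_mul, Finset.sum_ite_eq',
      Finset.mem_univ, if_true]
    refine Finset.sum_congr rfl fun i _ => ?_
    have h1 := hy i
    have h2 := hy (τ i)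
    simp only [s]
    field_simp

/-- A complex nondegenerate `ε`-isometric symmetric form for a real matrix, isotropic at a real
vector, can be replaced by a real one. -/
lemma exists_real_symm_form {m : Type*} [Fintype m] [DecidableEq m]
    (ε : ℝ) (A : Matrix m m ℝ) (x : m → ℝ) (M : Matrix m m ℂ) (hM : M.det ≠ 0)
    (hsymm : M.IsSymm)
    (hAM : (A.map Complex.ofReal)ᵀ * M * A.map Complex.ofReal = (ε : ℂ) • M)
    (hx : (fun i => (x i : ℂ)) ⬝ᵥ M *ᵥ (fun i => (x i : ℂ)) = 0) :
    ∃ N : Matrix m m ℝ, N.det ≠ 0 ∧ N.IsSymm ∧ Aᵀ * N * A = ε • N ∧ x ⬝ᵥ N *ᵥ x = 0 := by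
  obtain ⟨t, ht⟩ := exists_real_det_add_smul_ne_zero_s13 M hM
  have hre : Aᵀ * M.map Complex.re * A = ε • M.map Complex.re := by
    ext i j
    have := congrArg Complex.re (congrFun (congrFun hAM i) j)
    simpa [mul_apply] using this
  have him : Aᵀ * M.map Complex.im * A = ε • M.map Complex.im := by
    ext i j
    have := congrArg Complex.im (congrFun (congrFun hAM i) j)
    simpa [mul_apply] using this
  have hxre : x ⬝ᵥ M.map Complex.re *ᵥ x = 0 := by
    have := congrArg Complex.re hx
    simpa [dotProduct, mulVec] using this
  have hxim : x ⬝ᵥ M.map Complex.im *ᵥ x = 0 := by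
    have := congrArg Complex.im hx
    simpa [dotProduct, mulVec] using this
  refine ⟨_, ht, ?_, ?_, ?_⟩
  · ext i j
    simp [hsymm.apply i j]
  · rw [mul_add, add_mul, mul_smul_comm, smul_mul_assoc, hre, him, smul_add, smul_comm t]
  · rw [add_mulVec, smul_mulVec, dotProduct_add, dotProduct_smul, hxre, hxim, smul_zero, add_zero]

theorem stmt_13 {n : ℕ} (hn : 2 ≤ n) (ε : ℝ) (hε : ε = 1 ∨ ε = -1)
    (A : Matrix (Fin (n + 1)) (Fin (n + 1)) ℝ)
    (hA : IsUnit A)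
    -- `A` is semisimple: diagonalizable over `ℂ`
    (hsemi : ∃ P : Matrix (Fin (n + 1)) (Fin (n + 1)) ℂ, IsUnit P ∧
      ∃ d : Fin (n + 1) → ℂ, P * A.map (Complex.ofReal) * P⁻¹ = Matrix.diagonal d)
    -- `A` is similar to `ε A⁻¹`
    (hsim : ∃ Q : Matrix (Fin (n + 1)) (Fin (n + 1)) ℝ, IsUnit Q ∧ Q * A * Q⁻¹ = ε • A⁻¹)
    (X₀ : Fin n → ℝ) :
    -- (a) `X₀` lies in a proper `F`-invariant affine variety, or
    (∃ U : Submodule ℝ (Fin (n + 1) → ℝ), U ≠ ⊤ ∧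
        (∀ u ∈ U, A.mulVec u ∈ U) ∧ lhom X₀ ∈ U) ∨
    -- (b) the whole orbit of `X₀` lies in a non-degenerate `F`-invariant quadric `Q(M)`
    (∃ M : Matrix (Fin (n + 1)) (Fin (n + 1)) ℝ, M.det ≠ 0 ∧ M.IsSymm ∧
        Aᵀ * M * A = ε • M ∧ lhom X₀ ⬝ᵥ M.mulVec (lhom X₀) = 0) := by
  classical
  obtain ⟨P, hP, d, hPd⟩ := hsemi
  obtain ⟨Q, hQ, hQA⟩ := hsim
  have hε0 : (ε : ℂ) ≠ 0 := by rcases hε with rfl | rfl <;> simp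
  have hPdet := (isUnit_iff_isUnit_det P).mp hP
  have hQdet := (isUnit_iff_isUnit_det Q).mp hQ
  have hAdet := (isUnit_iff_isUnit_det A).mp hA
  set A' : Matrix (Fin (n + 1)) (Fin (n + 1)) ℂ := A.map Complex.ofReal with hA'
  have hPA : P * A' = diagonal d * P := by
    rw [← hPd, nonsing_inv_mul_cancel_right _ _ hPdet]
  have hrow : ∀ i, P i ᵥ* A' = d i • P i := by
    intro i
    ext j
    have := congrFun (congrFun hPA i) j
    rwa [diagonal_mul] at this
  have hP0 : ∀ i, P i ≠ 0 := fun i h => hPdet.ne_zero (det_eq_zero_of_row_eq_zero i (congrFun h))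
  set x : Fin (n + 1) → ℂ := fun i => (lhom X₀ i : ℂ) with hx
  by_cases hy : ∃ i, (P *ᵥ x) i = 0
  · obtain ⟨i, hi⟩ := hy
    exact Or.inl (exists_invariant_submodule_of_left_eigenvector A _ (P i) (d i) (hP0 i) (hrow i) hi)
  push Not at hy
  by_cases hd : Function.Injective d
  swap
  · left
    simp only [Function.Injective, not_forall] at hd
    obtain ⟨i, j, hij, hne⟩ := hd
    refine exists_invariant_submodule_of_left_eigenvector A _
      ((P *ᵥ x) j • P i - (P *ᵥ x) i • P j) (d i) ?_ ?_ ?_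
    · intro h
      have hli : LinearIndependent ℂ P.row := linearIndependent_rows_iff_isUnit.mpr hP
      have := linearIndependent_iff'.mp hli {i, j}
        (fun k => if k = i then (P *ᵥ x) j else -(P *ᵥ x) i)
        (by rw [Finset.sum_pair hne, if_pos rfl, if_neg (Ne.symm hne), neg_smul, ← sub_eq_add_neg]
            exact h) i (by simp)
      exact hy j (by simpa using this)
    · rw [sub_vecMul, smul_vecMul, smul_vecMul, hrow, hrow, ← hij, smul_sub, smul_comm (d i),
        smul_comm (d i)]
    · rw [sub_dotProduct, smul_dotProduct, smul_dotProduct]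
      change (P *ᵥ x) j * (P *ᵥ x) i - (P *ᵥ x) i * (P *ᵥ x) j = 0
      ring
  right
  have hAQA : A * Q * A = ε • Q := by
    have h : Q * A = ε • A⁻¹ * Q := by
      rw [← hQA, nonsing_inv_mul_cancel_right _ _ hQdet]
    rw [mul_assoc, h, smul_mul_assoc, mul_smul_comm, mul_nonsing_inv_cancel_left _ _ hAdet]
  have hAQA' : A' * Q.map Complex.ofReal * A' = (ε : ℂ) • Q.map Complex.ofReal := by
    ext i j
    have := congrArg Complex.ofReal (congrFun (congrFun hAQA i) j)
    simpa [hA', mul_apply] using this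
  set R := P * Q.map Complex.ofReal * P⁻¹ with hR
  have hRdet : R.det ≠ 0 := by
    have hQ' : (Q.map Complex.ofReal).det = (Q.det : ℂ) := (Complex.ofRealHom.map_det Q).symm
    rw [hR, det_conj hP, hQ']
    exact_mod_cast hQdet.ne_zero
  have hDRD : diagonal d * R * diagonal d = (ε : ℂ) • R := by
    have hAP : A' * P⁻¹ = P⁻¹ * diagonal d := by
      rw [← hPd, mul_assoc P, nonsing_inv_mul_cancel_left _ _ hPdet]
    calc diagonal d * R * diagonal d
        = (diagonal d * P) * Q.map Complex.ofReal * (P⁻¹ * diagonal d) := by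
          simp only [hR, mul_assoc]
      _ = P * (A' * Q.map Complex.ofReal * A') * P⁻¹ := by
          rw [← hPA, ← hAP]; simp only [mul_assoc]
      _ = (ε : ℂ) • R := by rw [hAQA', mul_smul_comm, smul_mul_assoc]
  have hpair : ∀ i, ∃ j, d i * d j = ε := by
    intro i
    have : ∃ j, R i j ≠ 0 := by
      by_contra! h
      exact hRdet (det_eq_zero_of_row_eq_zero i h)
    obtain ⟨j, hj⟩ := this
    have h := congrFun (congrFun hDRD i) j
    rw [mul_diagonal, diagonal_mul, Matrix.smul_apply, smul_eq_mul] at h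
    exact ⟨j, mul_right_cancel₀ hj (by rw [← h]; ring)⟩
  choose τ hτ using hpair
  have hinv : Function.Involutive τ := by
    intro i
    apply hd
    have h0 : d (τ i) ≠ 0 := right_ne_zero_of_mul (by rw [hτ i]; exact hε0)
    apply mul_left_cancel₀ h0
    rw [hτ, mul_comm, hτ]
  obtain ⟨K, hKdet, hKsymm, hKd, hKy⟩ :=
    exists_symm_form_diagonal (by simp; omega) (ε : ℂ) d (P *ᵥ x) hy τ hinv hτ
  refine exists_real_symm_form ε A _ (Pᵀ * K * P) ?_ ?_ ?_ ?_
  · rw [det_mul, det_mul, det_transpose]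
    exact mul_ne_zero (mul_ne_zero hPdet.ne_zero hKdet) hPdet.ne_zero
  · rw [IsSymm, transpose_mul, transpose_mul, transpose_transpose, hKsymm.eq, mul_assoc]
  · have hPA' : A'ᵀ * Pᵀ = Pᵀ * diagonal d := by
      rw [← transpose_mul, hPA, transpose_mul, diagonal_transpose]
    calc A'ᵀ * (Pᵀ * K * P) * A' = (A'ᵀ * Pᵀ) * K * (P * A') := by simp only [mul_assoc]
      _ = Pᵀ * (diagonal d * K * diagonal d) * P := by
          rw [hPA', hPA]; simp only [mul_assoc]
      _ = (ε : ℂ) • (Pᵀ * K * P) := by rw [hKd, mul_smul_comm, smul_mul_assoc]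
  · change x ⬝ᵥ (Pᵀ * K * P) *ᵥ x = 0
    rw [← hKy, mul_assoc, ← mulVec_mulVec, ← mulVec_mulVec, dotProduct_mulVec, vecMul_transpose]
end

section
/- Let ε ∈ {1,−1}, let A ∈ ℝ^{(n+1)×(n+1)}, and let λ ∈ ℝ with |λ| ≠ 1 and X_λ ∈ ℝ^n be such that Aℓ(X_λ) = λℓ(X_λ) (so X_λ is a fixed point of F = q ∘ A ∘ ℓ associated to the eigenvalue λ). Then for every invertible symmetric matrix M ∈ ℝ^{(n+1)×(n+1)} with AᵀMA = εM one has ℓ(X_λ)ᵀMℓ(X_λ) = 0; that is, every F-invariant non-degenerate quadric Q(M) contains the point X_λ. -/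
open Matrix

theorem stmt_15 {n : ℕ} (hn : 2 ≤ n) (ε : ℝ) (hε : ε = 1 ∨ ε = -1)
    (A : Matrix (Fin (n + 1)) (Fin (n + 1)) ℝ)
    (lam : ℝ) (hlam : |lam| ≠ 1) (Xlam : Fin n → ℝ)
    -- `X_λ` is a fixed point of `F` associated to the eigenvalue `λ`
    (hfix : A.mulVec (lhom Xlam) = lam • lhom Xlam) :
    ∀ M : Matrix (Fin (n + 1)) (Fin (n + 1)) ℝ, M.det ≠ 0 → M.IsSymm →
      Aᵀ * M * A = ε • M → lhom Xlam ⬝ᵥ M.mulVec (lhom Xlam) = 0 := by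
  intro M _ _ hM
  have h : lam * (lam * (lhom Xlam ⬝ᵥ M *ᵥ lhom Xlam)) = ε * (lhom Xlam ⬝ᵥ M *ᵥ lhom Xlam) := by
    calc lam * (lam * (lhom Xlam ⬝ᵥ M *ᵥ lhom Xlam))
        = (A *ᵥ lhom Xlam) ⬝ᵥ M *ᵥ (A *ᵥ lhom Xlam) := by
          rw [hfix, mulVec_smul, smul_dotProduct, dotProduct_smul, smul_eq_mul, smul_eq_mul]
      _ = lhom Xlam ⬝ᵥ (Aᵀ * M * A) *ᵥ lhom Xlam := by
          rw [← mulVec_mulVec, ← mulVec_mulVec, dotProduct_mulVec (lhom Xlam) Aᵀ,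
            vecMul_transpose]
      _ = ε * (lhom Xlam ⬝ᵥ M *ᵥ lhom Xlam) := by
          rw [hM, smul_mulVec, dotProduct_smul, smul_eq_mul]
  have hne : lam ^ 2 - ε ≠ 0 := by
    rcases hε with rfl | rfl
    · intro h0
      exact hlam ((sq_eq_sq₀ (abs_nonneg lam) zero_le_one).mp (by rw [sq_abs]; linarith))
    · rw [sub_neg_eq_add]
      positivity
  exact (mul_eq_zero.mp (by linear_combination h :
    (lam ^ 2 - ε) * (lhom Xlam ⬝ᵥ M *ᵥ lhom Xlam) = 0)).resolve_left hne
end
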